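/- arXiv:2411.08110 — 6 statements merged into one kernel-verified Lean document; each statement's English description precedes it below -/
import Mathlib

section
/- A family {T^i}_{i=1}^N of positive semidefinite matrices on ℂ^{d_I}⊗ℂ^{d_O} is a single-copy tester (i.e., there exist d_E ≥ 1, a state ρ_{IE} on ℂ^{d_I}⊗ℂ^{d_E} and an N-outcome POVM {M^i_{EO}} on ℂ^{d_E}⊗ℂ^{d_O} such that T^i = ρ_{IE} * (M^i_{EO})^T for all i) if and only if there exists a state σ on ℂ^{d_I} such that ∑_{i=1}^N T^i = σ ⊗ 1_{d_O}. Moreover, whenever such a realization exists, the memory dimension can be chosen as d_E = d_I. -/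
open Matrix BigOperators ComplexOrder

noncomputable section

/-- A quantum state on a finite-dimensional system: a positive semidefinite matrix of trace one. -/
def IsState {n : Type*} [Fintype n] (ρ : Matrix n n ℂ) : Prop :=
  ρ.PosSemidef ∧ ρ.trace = 1

/-- A POVM: a finite family of positive semidefinite matrices summing to the identity. -/
def IsPOVM {n ι : Type*} [Fintype n] [DecidableEq n] [Fintype ι]
    (M : ι → Matrix n n ℂ) : Prop :=
  (∀ i, (M i).PosSemidef) ∧ ∑ i, M i = (1 : Matrix n n ℂ)

/-- The link product `X * Y = Tr_E[(X^{T_E} ⊗ 1_B)(1_A ⊗ Y)]` of a matrix `X` on `A ⊗ E`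
with a matrix `Y` on `E ⊗ B`, written out entrywise. -/
def linkE {A E B : Type*} [Fintype E]
    (X : Matrix (A × E) (A × E) ℂ) (Y : Matrix (E × B) (E × B) ℂ) :
    Matrix (A × B) (A × B) ℂ :=
  Matrix.of fun p q => ∑ e : E, ∑ f : E, X (p.1, f) (q.1, e) * Y (f, p.2) (e, q.2)

open scoped Kronecker

/-- A positive semidefinite matrix has a factor `s` with a generalized inverse `g` such that
`g * s` is Hermitian. -/
theorem Matrix.PosSemidef.exists_factor_generalized_inverse {n : Type*} [Fintype n] [DecidableEq n]
    {σ : Matrix n n ℂ} (hσ : σ.PosSemidef) :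
    ∃ s g : Matrix n n ℂ, s * sᴴ = σ ∧ s * (g * s) = s ∧ (g * s).IsHermitian := by
  set U : Matrix n n ℂ := (hσ.isHermitian.eigenvectorUnitary : Matrix n n ℂ)
  have hUU : Uᴴ * U = 1 := by
    simpa [star_eq_conjTranspose] using Unitary.coe_star_mul_self hσ.isHermitian.eigenvectorUnitary
  let r : n → ℂ := fun i => (Real.sqrt (hσ.isHermitian.eigenvalues i) : ℂ)
  have hQ : (diagonal r⁻¹ * Uᴴ) * (U * diagonal r) = diagonal (r⁻¹ * r) := by
    rw [Matrix.mul_assoc, ← Matrix.mul_assoc Uᴴ, hUU, Matrix.one_mul, diagonal_mul_diagonal]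
    rfl
  refine ⟨U * diagonal r, diagonal r⁻¹ * Uᴴ, ?_, ?_, ?_⟩
  · have hs := hσ.isHermitian.spectral_theorem
    rw [Unitary.conjStarAlgAut_apply] at hs
    conv_rhs => rw [hs]
    rw [conjTranspose_mul, diagonal_conjTranspose, Matrix.mul_assoc, ← Matrix.mul_assoc (diagonal r),
      diagonal_mul_diagonal, ← Matrix.mul_assoc]
    congr 3
    ext i
    simp only [r, Pi.star_apply, RCLike.star_def, Complex.conj_ofReal, Function.comp_apply]
    rw [← Complex.ofReal_mul, Real.mul_self_sqrt (hσ.eigenvalues_nonneg i)]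
    rfl
  · rw [hQ, Matrix.mul_assoc, diagonal_mul_diagonal]
    congr 2
    ext i
    by_cases h : r i = 0 <;> simp [h]
  · rw [hQ]
    refine isHermitian_diagonal_of_self_adjoint _ ?_
    ext i
    simp [r]

/-- If `A * T * Aᴴ = 0` with `T` positive semidefinite, then `T * Aᴴ = 0`. -/
theorem Matrix.PosSemidef.mul_conjTranspose_eq_zero {m n : Type*} [Fintype m] [Fintype n]
    {T : Matrix n n ℂ} (hT : T.PosSemidef) {A : Matrix m n ℂ} (h : A * T * Aᴴ = 0) :
    T * Aᴴ = 0 := by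
  classical
  obtain ⟨s, -, rfl, -⟩ := hT.exists_factor_generalized_inverse
  have : (A * s) * (A * s)ᴴ = 0 := by
    simpa [conjTranspose_mul, Matrix.mul_assoc] using h
  rw [Matrix.mul_assoc, ← conjTranspose_mul, self_mul_conjTranspose_eq_zero.mp this,
    conjTranspose_zero, Matrix.mul_zero]

/-- A finite sum of positive semidefinite matrices vanishes only if every summand does. -/
theorem Matrix.eq_zero_of_sum_posSemidef_eq_zero {ι n : Type*} [Fintype ι] [Fintype n]
    {T : ι → Matrix n n ℂ} (hT : ∀ i, (T i).PosSemidef) (h : ∑ i, T i = 0) (i : ι) : T i = 0 := by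
  rw [← (hT i).trace_eq_zero_iff]
  have ht : ∑ i, (T i).trace = 0 := by rw [← trace_sum, h, trace_zero]
  exact (Finset.sum_eq_zero_iff_of_nonneg fun j _ => (hT j).trace_nonneg).mp ht i
    (Finset.mem_univ i)

/-- The partial trace of a state over its second factor is a state. -/
theorem IsState.traceRight {A E : Type*} [Fintype A] [Fintype E]
    {ρ : Matrix (A × E) (A × E) ℂ} (hρ : IsState ρ) :
    IsState (Matrix.of fun a a' => ∑ e, ρ (a, e) (a', e)) := by
  constructor
  · have : (Matrix.of fun a a' => ∑ e, ρ (a, e) (a', e)) =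
        ∑ e, ρ.submatrix (fun a => (a, e)) (fun a => (a, e)) := by
      ext a a'
      simp [Matrix.sum_apply]
    rw [this]
    exact posSemidef_sum _ fun e _ => hρ.1.submatrix _
  · rw [← hρ.2]
    simp [Matrix.trace, Fintype.sum_prod_type]

theorem linkE_one {A E B : Type*} [Fintype E] [DecidableEq E] [DecidableEq B]
    (ρ : Matrix (A × E) (A × E) ℂ) :
    linkE ρ (1 : Matrix (E × B) (E × B) ℂ) =
      (Matrix.of fun a a' => ∑ e, ρ (a, e) (a', e)) ⊗ₖ (1 : Matrix B B ℂ) := by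
  ext ⟨a, b⟩ ⟨a', b'⟩
  by_cases h : b = b' <;> simp [linkE, Matrix.one_apply, h]

theorem linkE_sum {ι A E B : Type*} [Fintype ι] [Fintype E] (ρ : Matrix (A × E) (A × E) ℂ)
    (Y : ι → Matrix (E × B) (E × B) ℂ) : ∑ i, linkE ρ (Y i) = linkE ρ (∑ i, Y i) := by
  ext p q
  simp only [linkE, Matrix.sum_apply, Matrix.of_apply, Finset.mul_sum]
  rw [Finset.sum_comm]
  refine Finset.sum_congr rfl fun e _ => Finset.sum_comm

/-- Linking with the vectorization of `s` is conjugation by `s ⊗ 1`. -/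
theorem linkE_vecMulVec {A E B : Type*} [Fintype E] [Fintype B] [DecidableEq B]
    (s : Matrix A E ℂ) (Y : Matrix (E × B) (E × B) ℂ) :
    linkE (vecMulVec (fun p : A × E => s p.1 p.2) (star fun p : A × E => s p.1 p.2)) Y =
      (s ⊗ₖ (1 : Matrix B B ℂ)) * Y * (s ⊗ₖ (1 : Matrix B B ℂ))ᴴ := by
  ext ⟨a, b⟩ ⟨a', b'⟩
  simp [linkE, Matrix.mul_apply, Fintype.sum_prod_type, vecMulVec_apply, Matrix.one_apply,
    Finset.sum_mul, apply_ite]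
  refine Finset.sum_congr rfl fun e _ => Finset.sum_congr rfl fun f _ => ?_
  ring

theorem exists_sum_eq_kronecker_of_linkE {ι A E B : Type*} [Fintype ι] [Fintype A]
    [Fintype E] [DecidableEq E] [Fintype B] [DecidableEq B]
    {ρ : Matrix (A × E) (A × E) ℂ} {M : ι → Matrix (E × B) (E × B) ℂ}
    (hρ : IsState ρ) (hM : IsPOVM M) :
    ∃ σ : Matrix A A ℂ, IsState σ ∧ ∑ i, linkE ρ (M i)ᵀ = σ ⊗ₖ (1 : Matrix B B ℂ) := by
  refine ⟨_, hρ.traceRight, ?_⟩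
  rw [linkE_sum, ← transpose_sum, hM.2, transpose_one, linkE_one]

theorem exists_povm_conj_eq {ι A B : Type*} [Fintype ι] [Fintype A] [DecidableEq A]
    [Fintype B] [DecidableEq B] {T : ι → Matrix (A × B) (A × B) ℂ}
    (hT : ∀ i, (T i).PosSemidef) {σ : Matrix A A ℂ} (hσ : IsState σ)
    (hsum : ∑ i, T i = σ ⊗ₖ (1 : Matrix B B ℂ)) :
    ∃ (s : Matrix A A ℂ) (M : ι → Matrix (A × B) (A × B) ℂ), s * sᴴ = σ ∧ IsPOVM M ∧
      ∀ i, T i = (s ⊗ₖ (1 : Matrix B B ℂ)) * M i * (s ⊗ₖ (1 : Matrix B B ℂ))ᴴ := by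
  classical
  obtain ⟨s, g, hs, hsgs, hQ⟩ := hσ.1.exists_factor_generalized_inverse
  rcases isEmpty_or_nonempty ι with hι | ⟨⟨i₀⟩⟩
  · refine ⟨s, fun i => isEmptyElim i, hs, ⟨fun i => isEmptyElim i, ?_⟩, fun i => isEmptyElim i⟩
    rcases isEmpty_or_nonempty B with hB | ⟨⟨b⟩⟩
    · exact Subsingleton.elim _ _
    · have : σ = 0 := by
        ext a a'
        simpa using (congrFun (congrFun hsum (a, b)) (a', b)).symm
      simpa [this] using hσ.2
  set S : Matrix (A × B) (A × B) ℂ := s ⊗ₖ 1 with hS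
  set G : Matrix (A × B) (A × B) ℂ := g ⊗ₖ 1 with hG
  have hSS : ∑ i, T i = S * Sᴴ := by
    rw [hsum, hS, conjTranspose_kronecker, ← mul_kronecker_mul, hs]
    simp
  have hSGS : S * (G * S) = S := by
    simp only [hS, hG, ← mul_kronecker_mul, hsgs, Matrix.mul_one]
  have hGS : (G * S)ᴴ = G * S := by
    simp only [hS, hG, ← mul_kronecker_mul, conjTranspose_kronecker, hQ.eq, Matrix.mul_one,
      conjTranspose_one]
  have hidem : G * S * (G * S) = G * S := by rw [Matrix.mul_assoc, hSGS]
  clear_value S G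
  have hproj : (1 - G * S).PosSemidef := by
    have : 1 - G * S = (1 - G * S)ᴴ * (1 - G * S) := by
      rw [conjTranspose_sub, conjTranspose_one, hGS]
      simp [Matrix.sub_mul, Matrix.mul_sub, hidem]
    rw [this]
    exact posSemidef_conjTranspose_mul_self _
  have hker (i : ι) : T i * (S * G)ᴴ = T i := by
    have h0 : (1 - S * G) * S = 0 := by
      rw [Matrix.sub_mul, Matrix.one_mul, Matrix.mul_assoc, hSGS, sub_self]
    have h1 : ∑ i, (1 - S * G) * T i * (1 - S * G)ᴴ = 0 := by
      rw [← Finset.sum_mul, ← Finset.mul_sum, hSS, ← Matrix.mul_assoc, h0]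
      simp
    have h2 := (hT i).mul_conjTranspose_eq_zero
      (eq_zero_of_sum_posSemidef_eq_zero (fun i => (hT i).mul_mul_conjTranspose_same _) h1 i)
    rw [conjTranspose_sub, conjTranspose_one, Matrix.mul_sub, Matrix.mul_one, sub_eq_zero] at h2
    exact h2.symm
  have hker' (i : ι) : S * G * T i = T i := by
    simpa [(hT i).isHermitian.eq] using congrArg conjTranspose (hker i)
  refine ⟨s, fun i => G * T i * Gᴴ + if i = i₀ then 1 - G * S else 0, hs, ⟨fun i => ?_, ?_⟩,
    fun i => ?_⟩
  · refine ((hT i).mul_mul_conjTranspose_same _).add ?_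
    split_ifs
    exacts [hproj, .zero]
  · rw [Finset.sum_add_distrib, ← Finset.sum_mul, ← Finset.mul_sum, hSS, Finset.sum_ite_eq']
    have : G * (S * Sᴴ) * Gᴴ = G * S := by
      calc G * (S * Sᴴ) * Gᴴ = G * S * (G * S)ᴴ := by simp [Matrix.mul_assoc]
        _ = G * S := by rw [hGS, hidem]
    simp [this]
  · have h0 : S * (if i = i₀ then 1 - G * S else 0) = 0 := by
      split_ifs <;> simp [Matrix.mul_sub, hSGS]
    rw [← hS, Matrix.mul_add, h0, add_zero]
    calc T i = S * G * T i * (S * G)ᴴ := by rw [hker', hker]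
      _ = S * (G * T i * Gᴴ) * Sᴴ := by simp [Matrix.mul_assoc]

theorem exists_linkE_eq_of_sum_eq_kronecker {ι A B : Type*} [Fintype ι] [Fintype A]
    [DecidableEq A] [Fintype B] [DecidableEq B] {T : ι → Matrix (A × B) (A × B) ℂ}
    (hT : ∀ i, (T i).PosSemidef) {σ : Matrix A A ℂ} (hσ : IsState σ)
    (hsum : ∑ i, T i = σ ⊗ₖ (1 : Matrix B B ℂ)) :
    ∃ (ρ : Matrix (A × A) (A × A) ℂ) (M : ι → Matrix (A × B) (A × B) ℂ),
      IsState ρ ∧ IsPOVM M ∧ ∀ i, T i = linkE ρ (M i)ᵀ := by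
  obtain ⟨s, M, hs, hM, hTM⟩ := exists_povm_conj_eq hT hσ hsum
  refine ⟨vecMulVec (fun p => s p.1 p.2) (star fun p => s p.1 p.2), fun i => (M i)ᵀ,
    ⟨posSemidef_vecMulVec_self_star _, ?_⟩, ⟨fun i => (hM.1 i).transpose, ?_⟩, fun i => ?_⟩
  · rw [← hσ.2, ← hs]
    simp [Matrix.trace, Matrix.mul_apply, Fintype.sum_prod_type, vecMulVec_apply]
  · rw [← transpose_sum, hM.2, transpose_one]
  · rw [transpose_transpose, linkE_vecMulVec, hTM i]

/-- A family of positive semidefinite matrices on `ℂ^{d_I} ⊗ ℂ^{d_O}` is a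
single-copy tester, i.e. it admits a realization `T^i = ρ_{IE} * (M^i_{EO})ᵀ` with a state
`ρ_{IE}` and a POVM `{M^i_{EO}}` on some memory system `E`, if and only if the tester elements
sum to `σ ⊗ 1_O` for some state `σ` on the input system.  Moreover, in that case the memory
dimension can always be chosen to be `d_E = d_I`. -/
theorem single_copy_tester_characterisation {dI dO N : ℕ}
    (T : Fin N → Matrix (Fin dI × Fin dO) (Fin dI × Fin dO) ℂ)
    (hT : ∀ i, (T i).PosSemidef) :
    ((∃ (dE : ℕ), 1 ≤ dE ∧
        ∃ (ρ : Matrix (Fin dI × Fin dE) (Fin dI × Fin dE) ℂ)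
          (M : Fin N → Matrix (Fin dE × Fin dO) (Fin dE × Fin dO) ℂ),
          IsState ρ ∧ IsPOVM M ∧ ∀ i, T i = linkE ρ (M i)ᵀ) ↔
      (∃ σ : Matrix (Fin dI) (Fin dI) ℂ, IsState σ ∧
        ∑ i, T i = Matrix.kroneckerMap (· * ·) σ (1 : Matrix (Fin dO) (Fin dO) ℂ)))
    ∧
    ((∃ σ : Matrix (Fin dI) (Fin dI) ℂ, IsState σ ∧
        ∑ i, T i = Matrix.kroneckerMap (· * ·) σ (1 : Matrix (Fin dO) (Fin dO) ℂ)) →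
      ∃ (ρ : Matrix (Fin dI × Fin dI) (Fin dI × Fin dI) ℂ)
        (M : Fin N → Matrix (Fin dI × Fin dO) (Fin dI × Fin dO) ℂ),
        IsState ρ ∧ IsPOVM M ∧ ∀ i, T i = linkE ρ (M i)ᵀ) := by
  have key : (∃ σ : Matrix (Fin dI) (Fin dI) ℂ, IsState σ ∧
      ∑ i, T i = Matrix.kroneckerMap (· * ·) σ (1 : Matrix (Fin dO) (Fin dO) ℂ)) →
      ∃ (ρ : Matrix (Fin dI × Fin dI) (Fin dI × Fin dI) ℂ)
        (M : Fin N → Matrix (Fin dI × Fin dO) (Fin dI × Fin dO) ℂ),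
        IsState ρ ∧ IsPOVM M ∧ ∀ i, T i = linkE ρ (M i)ᵀ := fun ⟨_, hσ, hsum⟩ =>
    exists_linkE_eq_of_sum_eq_kronecker hT hσ hsum
  refine ⟨⟨?_, fun h => ⟨dI, ?_, key h⟩⟩, key⟩
  · rintro ⟨dE, -, ρ, M, hρ, hM, hTM⟩
    simp only [hTM]
    exact exists_sum_eq_kronecker_of_linkE hρ hM
  · obtain ⟨σ, hσ, -⟩ := h
    rw [Nat.one_le_iff_ne_zero]
    rintro rfl
    simpa using hσ.2
end
end

section
/- Let d ≥ 1 and let the ensemble consist of the d² unitary channels ρ ↦ (X_d^i Z_d^j) ρ (X_d^i Z_d^j)† for 0 ≤ i,j ≤ d−1, each with probability 1/d². For every d_E ≥ 1, the maximum over memory-d_E single-copy testers {T^{(i,j)}}_{i,j=0}^{d−1} on ℂ^d⊗ℂ^d of the success probability (1/d²)∑_{i,j} Tr(T^{(i,j)} C^{(i,j)}), where C^{(i,j)} is the Choi matrix of the unitary X_d^i Z_d^j, equals min{1, d_E/d}. -/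
open Matrix BigOperators ComplexOrder

noncomputable section

/-- The primitive `d`-th root of unity `ω = e^{2πi/d}`. -/
def omega (d : ℕ) : ℂ := Complex.exp (2 * (Real.pi : ℂ) * Complex.I / d)

/-- The clock operator `X_d = ∑_l |l⊕1⟩⟨l|`. -/
def clockX (d : ℕ) [NeZero d] : Matrix (Fin d) (Fin d) ℂ :=
  Matrix.of fun k l => if k = l + 1 then 1 else 0

/-- The shift operator `Z_d = ∑_l ω^l |l⟩⟨l|`. -/
def clockZ (d : ℕ) : Matrix (Fin d) (Fin d) ℂ :=
  Matrix.diagonal fun l => omega d ^ (l : ℕ)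

/-- The clock-shift unitary `X_d^i Z_d^j`. -/
def clockShift (d : ℕ) [NeZero d] (i j : Fin d) : Matrix (Fin d) (Fin d) ℂ :=
  clockX d ^ (i : ℕ) * clockZ d ^ (j : ℕ)

/-- The Choi matrix `|U⟩⟩⟨⟨U|` of the unitary channel of `U`, with `|U⟩⟩ = ∑_l |l⟩ ⊗ U|l⟩`. -/
def choiU {d : ℕ} (U : Matrix (Fin d) (Fin d) ℂ) :
    Matrix (Fin d × Fin d) (Fin d × Fin d) ℂ :=
  Matrix.of fun p q => U p.2 p.1 * starRingEnd ℂ (U q.2 q.1)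

open scoped MatrixOrder Matrix.Norms.L2Operator in
theorem trace_mul_nonneg_of_posSemidef {n : Type*} [Fintype n] {A B : Matrix n n ℂ}
    (hA : A.PosSemidef) (hB : B.PosSemidef) : 0 ≤ (A * B).trace := by
  classical
  obtain ⟨C, rfl⟩ := CStarAlgebra.nonneg_iff_eq_star_mul_self.mp hB.nonneg
  rw [star_eq_conjTranspose, ← Matrix.mul_assoc, Matrix.trace_mul_comm, ← Matrix.mul_assoc]
  exact (hA.mul_mul_conjTranspose_same C).trace_nonneg

theorem posSemidef_trace_smul_one_sub {n : Type*} [Fintype n] [DecidableEq n] {A : Matrix n n ℂ}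
    (hA : A.PosSemidef) : (A.trace • (1 : Matrix n n ℂ) - A).PosSemidef := by
  have hH := hA.isHermitian
  let V : Matrix n n ℂ := hH.eigenvectorUnitary
  have hV : V * Vᴴ = 1 := Unitary.mul_star_self_of_mem hH.eigenvectorUnitary.2
  have hspec : A = V * diagonal (fun i => (hH.eigenvalues i : ℂ)) * Vᴴ := by
    conv_lhs => rw [hH.spectral_theorem, Unitary.conjStarAlgAut_apply]
    rfl
  have key : A.trace • (1 : Matrix n n ℂ) - A =
      V * (diagonal fun i => A.trace - (hH.eigenvalues i : ℂ)) * Vᴴ := by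
    have hd : (diagonal fun i => A.trace - (hH.eigenvalues i : ℂ)) =
        A.trace • (1 : Matrix n n ℂ) - diagonal (fun i => (hH.eigenvalues i : ℂ)) := by
      ext i j
      by_cases h : i = j <;> simp [h]
    rw [hd, Matrix.mul_sub, Matrix.sub_mul, ← hspec]
    simp [hV]
  rw [key]
  refine PosSemidef.mul_mul_conjTranspose_same (PosSemidef.diagonal fun i => ?_) V
  rw [Pi.zero_apply, sub_nonneg, hH.trace_eq_sum_eigenvalues]
  exact Finset.single_le_sum (f := fun i => (hH.eigenvalues i : ℂ))
    (fun j _ => by exact_mod_cast hA.eigenvalues_nonneg j) (Finset.mem_univ i)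

theorem trace_mul_le_trace_left {n : Type*} [Fintype n] [DecidableEq n] {M σ : Matrix n n ℂ}
    (hM : M.PosSemidef) (hσ : IsState σ) : (M * σ).trace ≤ M.trace := by
  have h := trace_mul_nonneg_of_posSemidef hM (posSemidef_trace_smul_one_sub hσ.1)
  simpa [hσ.2, Matrix.mul_sub] using h

theorem IsPOVM.trace_mul_le_one {n ι : Type*} [Fintype n] [DecidableEq n] [Fintype ι]
    {M : ι → Matrix n n ℂ} (hM : IsPOVM M) (i : ι) {σ : Matrix n n ℂ} (hσ : IsState σ) :
    (M i * σ).trace ≤ 1 := by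
  have h : (M i * σ).trace ≤ ∑ k, (M k * σ).trace :=
    Finset.single_le_sum (f := fun k => (M k * σ).trace)
      (fun k _ => trace_mul_nonneg_of_posSemidef (hM.1 k) hσ.1) (Finset.mem_univ i)
  rwa [← Matrix.trace_sum, ← Finset.sum_mul, hM.2, Matrix.one_mul, hσ.2] at h

theorem IsPOVM.sum_trace {n ι : Type*} [Fintype n] [DecidableEq n] [Fintype ι]
    {M : ι → Matrix n n ℂ} (hM : IsPOVM M) : ∑ i, (M i).trace = Fintype.card n := by
  rw [← Matrix.trace_sum, hM.2, Matrix.trace_one]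

/-- The operator `Ū ⊗ 1_E`, followed by the exchange of the two tensor factors. -/
def conjLift {A B : Type*} (E : Type*) [DecidableEq E] (U : Matrix B A ℂ) : Matrix (E × B) (A × E) ℂ :=
  Matrix.of fun p q => if p.1 = q.2 then starRingEnd ℂ (U p.2 q.1) else 0

theorem conjLift_mul_mul_conjTranspose_apply {A B E : Type*} [Fintype A] [Fintype E]
    [DecidableEq E] (U : Matrix B A ℂ) (ρ : Matrix (A × E) (A × E) ℂ) (p q : E × B) :
    (conjLift E U * ρ * (conjLift E U)ᴴ) p q =
      ∑ a, ∑ b, starRingEnd ℂ (U p.2 b) * ρ (b, p.1) (a, q.1) * U q.2 a := by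
  simp [Matrix.mul_apply, Fintype.sum_prod_type, conjLift, apply_ite, Finset.sum_mul]

theorem trace_linkE_mul_choiU {d : ℕ} {E : Type*} [Fintype E] [DecidableEq E]
    (ρ : Matrix (Fin d × E) (Fin d × E) ℂ) (M : Matrix (E × Fin d) (E × Fin d) ℂ)
    (U : Matrix (Fin d) (Fin d) ℂ) :
    (linkE ρ Mᵀ * choiU U).trace = (M * (conjLift E U * ρ * (conjLift E U)ᴴ)).trace := by
  simp only [Matrix.trace, Matrix.diag_apply, Matrix.mul_apply (M := M),
    conjLift_mul_mul_conjTranspose_apply]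
  simp only [Matrix.mul_apply, linkE, choiU, of_apply, transpose_apply, Finset.sum_mul,
    Finset.mul_sum, ← Fintype.sum_prod_type']
  refine Finset.sum_nbij' (fun x => ((x.2.2.1, x.2.1.2), (x.2.2.2, x.1.2), x.2.1.1, x.1.1))
    (fun y => ((y.2.2.2, y.2.1.2), (y.2.2.1, y.1.2), y.1.1, y.2.1.1)) ?_ ?_ ?_ ?_ ?_ <;>
    simp
  intros
  ring

theorem conjLift_conjTranspose_mul_self {A B E : Type*} [Fintype A] [DecidableEq A] [Fintype B]
    [Fintype E] [DecidableEq E] {U : Matrix B A ℂ} (hU : Uᴴ * U = 1) :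
    (conjLift E U)ᴴ * conjLift E U = 1 := by
  have h (a b : A) : ∑ x, U x a * starRingEnd ℂ (U x b) = if a = b then 1 else 0 := by
    have := congr_fun (congr_fun hU b) a
    simp only [Matrix.mul_apply, conjTranspose_apply, Matrix.one_apply] at this
    simpa [mul_comm, eq_comm] using this
  ext ⟨a, e⟩ ⟨b, f⟩
  by_cases hef : e = f
  · subst hef
    simp [Matrix.mul_apply, Fintype.sum_prod_type, conjLift, Matrix.one_apply, apply_ite, h]
  · simp [Matrix.mul_apply, Fintype.sum_prod_type, conjLift, apply_ite, hef, Ne.symm hef]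

theorem IsState.conjLift_mul_mul {A B E : Type*} [Fintype A] [DecidableEq A] [Fintype B]
    [Fintype E] [DecidableEq E] {ρ : Matrix (A × E) (A × E) ℂ} (hρ : IsState ρ)
    {U : Matrix B A ℂ} (hU : Uᴴ * U = 1) : IsState (conjLift E U * ρ * (conjLift E U)ᴴ) := by
  refine ⟨hρ.1.mul_mul_conjTranspose_same _, ?_⟩
  rw [Matrix.trace_mul_comm, ← Matrix.mul_assoc, conjLift_conjTranspose_mul_self hU,
    Matrix.one_mul, hρ.2]

theorem clockX_pow_apply (d : ℕ) [NeZero d] (n : ℕ) (k l : Fin d) :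
    (clockX d ^ n) k l = if k = l + Fin.ofNat d n then 1 else 0 := by
  induction n generalizing l with
  | zero => simp [Matrix.one_apply]
  | succ n ih =>
    have h : l + Fin.ofNat d (n + 1) = l + 1 + Fin.ofNat d n := by
      ext
      simp [Fin.val_add, add_comm, add_left_comm]
    rw [pow_succ, Matrix.mul_apply, h]
    simp_rw [ih]
    simp [clockX]

theorem clockShift_apply (d : ℕ) [NeZero d] (i j k l : Fin d) :
    clockShift d i j k l = if k = l + i then omega d ^ ((l : ℕ) * j) else 0 := by
  simp [clockShift, clockZ, Matrix.diagonal_pow, clockX_pow_apply, pow_mul]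

theorem isPrimitiveRoot_omega (d : ℕ) [NeZero d] : IsPrimitiveRoot (omega d) d :=
  Complex.isPrimitiveRoot_exp d (NeZero.ne d)

theorem star_omega (d : ℕ) [NeZero d] : starRingEnd ℂ (omega d) = (omega d)⁻¹ := by
  rw [← Complex.inv_eq_conj]
  exact (isPrimitiveRoot_omega d).norm'_eq_one (NeZero.ne d)

theorem omega_ne_zero (d : ℕ) : omega d ≠ 0 := Complex.exp_ne_zero _

theorem sum_omega_pow_mul_conj (d : ℕ) [NeZero d] (a b : Fin d) :
    ∑ j : Fin d, omega d ^ ((a : ℕ) * j) * starRingEnd ℂ (omega d ^ ((b : ℕ) * j)) =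
      if a = b then (d : ℂ) else 0 := by
  have hω := isPrimitiveRoot_omega d
  have h0 := omega_ne_zero d
  have hterm (j : Fin d) : omega d ^ ((a : ℕ) * j) * starRingEnd ℂ (omega d ^ ((b : ℕ) * j)) =
      (omega d ^ (a : ℕ) / omega d ^ (b : ℕ)) ^ (j : ℕ) := by
    rw [map_pow, star_omega, pow_mul, pow_mul, ← mul_pow, inv_pow, div_eq_mul_inv]
  simp_rw [hterm]
  split_ifs with hab
  · subst hab
    simp [h0]
  · rw [Fin.sum_univ_eq_sum_range
      (fun j => (omega d ^ (a : ℕ) / omega d ^ (b : ℕ)) ^ j), geom_sum_eq]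
    · rw [div_pow, ← pow_mul, ← pow_mul, mul_comm, mul_comm (b : ℕ), pow_mul, pow_mul,
        hω.pow_eq_one]
      simp
    · intro h
      exact hab (Fin.ext (hω.pow_inj a.2 b.2 (by simpa [div_eq_one_iff_eq, h0] using h)))

theorem conjTranspose_clockShift_mul_self (d : ℕ) [NeZero d] (i j : Fin d) :
    (clockShift d i j)ᴴ * clockShift d i j = 1 := by
  have h0 := omega_ne_zero d
  ext a b
  by_cases hab : a = b
  · subst hab
    simp [Matrix.mul_apply, clockShift_apply, apply_ite, star_omega, h0]
  · simp [Matrix.mul_apply, clockShift_apply, apply_ite, hab, Ne.symm hab]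

theorem sum_clockShift_mul_conj (d : ℕ) [NeZero d] (a b k l : Fin d) :
    ∑ ij : Fin d × Fin d, starRingEnd ℂ (clockShift d ij.1 ij.2 k a) * clockShift d ij.1 ij.2 l b =
      if k = l ∧ a = b then (d : ℂ) else 0 := by
  have hi (i : Fin d) :
      ∑ j, starRingEnd ℂ (clockShift d i j k a) * clockShift d i j l b =
        if k = a + i then if l = b + i then if a = b then (d : ℂ) else 0 else 0 else 0 := by
    have h := sum_omega_pow_mul_conj d b a
    simp_rw [eq_comm (a := b)] at h
    split_ifs at h ⊢ <;> simp_all [clockShift_apply, mul_comm]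
  rw [Fintype.sum_prod_type]
  simp_rw [hi, ← sub_eq_iff_eq_add']
  by_cases hab : a = b
  · subst hab
    simp [eq_comm]
  · simp [hab]

/-- The unnormalized maximally entangled vector, truncated to the smaller of the two factors. -/
def entangledVec (d dE : ℕ) : Fin d × Fin dE → ℂ :=
  fun p => if (p.1 : ℕ) = p.2 then 1 else 0

/-- The vector `(Ū ⊗ 1_E)` applied to `entangledVec`. -/
def outputVec {d : ℕ} (dE : ℕ) (U : Matrix (Fin d) (Fin d) ℂ) : Fin dE × Fin d → ℂ :=
  fun p => if h : (p.1 : ℕ) < d then starRingEnd ℂ (U p.2 ⟨p.1, h⟩) else 0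

theorem conjLift_mulVec_entangledVec {d : ℕ} (dE : ℕ) (U : Matrix (Fin d) (Fin d) ℂ) :
    conjLift (Fin dE) U *ᵥ entangledVec d dE = outputVec dE U := by
  ext ⟨e, b⟩
  simp only [mulVec, dotProduct, Fintype.sum_prod_type, conjLift, entangledVec, outputVec, of_apply]
  simp_rw [ite_mul, zero_mul, Finset.sum_ite_eq, Finset.mem_univ, if_true, mul_ite, mul_one,
    mul_zero]
  split_ifs with h
  · rw [Finset.sum_eq_single ⟨e, h⟩]
    · simp
    · intro a _ ha
      exact if_neg fun hae => ha (Fin.ext hae)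
    · simp
  · exact Finset.sum_eq_zero fun a _ => if_neg fun hae : (a : ℕ) = e => h (hae ▸ a.2)

theorem entangledVec_dotProduct_star (d dE : ℕ) :
    entangledVec d dE ⬝ᵥ star (entangledVec d dE) = (min d dE : ℕ) := by
  have h (a : Fin d) :
      ∑ e : Fin dE, (if (a : ℕ) = e then (1 : ℂ) else 0) = if (a : ℕ) < dE then 1 else 0 := by
    rw [Fin.sum_univ_eq_sum_range (fun e => if (a : ℕ) = e then (1 : ℂ) else 0)]
    simp
  simp only [dotProduct, Fintype.sum_prod_type, entangledVec, Pi.star_apply, apply_ite star,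
    star_one, star_zero, mul_ite, mul_one, mul_zero, ← ite_and, and_self, h]
  rw [Finset.sum_boole, Fin.card_filter_val_lt]

theorem outputVec_dotProduct {d : ℕ} (dE : ℕ) {U : Matrix (Fin d) (Fin d) ℂ} (hU : Uᴴ * U = 1) :
    star (outputVec dE U) ⬝ᵥ outputVec dE U = (min d dE : ℕ) := by
  rw [← conjLift_mulVec_entangledVec, star_mulVec, dotProduct_mulVec, vecMul_vecMul,
    conjLift_conjTranspose_mul_self hU, vecMul_one, dotProduct_comm, entangledVec_dotProduct_star]

/-- The maximally entangled state of Schmidt rank `min d dE`. -/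
def entangledState (d dE : ℕ) : Matrix (Fin d × Fin dE) (Fin d × Fin dE) ℂ :=
  ((min d dE : ℕ) : ℂ)⁻¹ • vecMulVec (entangledVec d dE) (star (entangledVec d dE))

/-- The projection onto the part of the memory not used by `entangledVec`. -/
def unusedProj (d dE : ℕ) : Matrix (Fin dE × Fin d) (Fin dE × Fin d) ℂ :=
  diagonal fun p => if (p.1 : ℕ) < d then 0 else 1

/-- The measurement in the basis of output vectors, completed uniformly on the unused memory. -/
def outputPOVM (d : ℕ) [NeZero d] (dE : ℕ) (ij : Fin d × Fin d) :
    Matrix (Fin dE × Fin d) (Fin dE × Fin d) ℂ :=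
  (d : ℂ)⁻¹ • vecMulVec (outputVec dE (clockShift d ij.1 ij.2))
      (star (outputVec dE (clockShift d ij.1 ij.2))) +
    ((d : ℂ) ^ 2)⁻¹ • unusedProj d dE

theorem isState_entangledState (d : ℕ) [NeZero d] {dE : ℕ} (hdE : 1 ≤ dE) :
    IsState (entangledState d dE) := by
  refine ⟨(posSemidef_vecMulVec_self_star _).smul (by positivity), ?_⟩
  have h : min d dE ≠ 0 := by have := NeZero.pos d; omega
  rw [entangledState, trace_smul, trace_vecMulVec, entangledVec_dotProduct_star, smul_eq_mul,
    inv_mul_cancel₀ (Nat.cast_ne_zero.mpr h)]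

theorem isPOVM_outputPOVM (d : ℕ) [NeZero d] (dE : ℕ) : IsPOVM (outputPOVM d dE) := by
  have hd : (d : ℂ) ≠ 0 := Nat.cast_ne_zero.mpr (NeZero.ne d)
  refine ⟨fun ij => ?_, ?_⟩
  · refine ((posSemidef_vecMulVec_self_star _).smul (by positivity)).add
      ((PosSemidef.diagonal fun p => ?_).smul (by positivity))
    dsimp only [Pi.zero_apply]
    split_ifs <;> simp
  · ext ⟨e, b⟩ ⟨f, c⟩
    simp only [Matrix.sum_apply, outputPOVM, Matrix.add_apply, Matrix.smul_apply, smul_eq_mul,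
      Finset.sum_add_distrib, ← Finset.mul_sum, vecMulVec_apply, Pi.star_apply, outputVec]
    by_cases he : (e : ℕ) < d
    · by_cases hf : (f : ℕ) < d
      · simp only [he, hf, dite_true, RCLike.star_def, Complex.conj_conj,
          sum_clockShift_mul_conj]
        by_cases hef : e = f <;> by_cases hbc : b = c
        · subst hef hbc
          simp [unusedProj, hd, he]
        all_goals simp [unusedProj, hef, hbc, ← Fin.ext_iff]
      · have hef : e ≠ f := fun h => hf (h ▸ he)
        simp [he, hf, hef, unusedProj]
    · simp only [he, dite_false, zero_mul, Finset.sum_const_zero, mul_zero, zero_add]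
      by_cases hef : e = f <;> by_cases hbc : b = c
      · subst hef hbc
        simp [unusedProj, he]
        field_simp
      all_goals simp [unusedProj, hef, hbc]

theorem trace_outputPOVM_mul (d : ℕ) [NeZero d] {dE : ℕ} (hdE : 1 ≤ dE) (ij : Fin d × Fin d) :
    (outputPOVM d dE ij * (conjLift (Fin dE) (clockShift d ij.1 ij.2) * entangledState d dE *
      (conjLift (Fin dE) (clockShift d ij.1 ij.2))ᴴ)).trace = (min d dE : ℕ) / (d : ℂ) := by
  have h : ((min d dE : ℕ) : ℂ) ≠ 0 :=
    Nat.cast_ne_zero.mpr (by have := NeZero.pos d; omega)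
  set U := clockShift d ij.1 ij.2 with hU
  have hP : unusedProj d dE *ᵥ outputVec dE U = 0 := by
    ext p
    simp only [unusedProj, mulVec_diagonal, outputVec]
    split_ifs <;> simp
  have hw : outputPOVM d dE ij *ᵥ outputVec dE U =
      ((min d dE : ℕ) / (d : ℂ)) • outputVec dE U := by
    rw [outputPOVM, ← hU, add_mulVec, smul_mulVec, smul_mulVec, hP, vecMulVec_mulVec,
      outputVec_dotProduct dE (conjTranspose_clockShift_mul_self d ij.1 ij.2)]
    ext
    simp
    ring
  rw [entangledState, Matrix.mul_smul, Matrix.smul_mul, mul_vecMulVec, vecMulVec_mul,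
    ← star_mulVec, conjLift_mulVec_entangledVec, Matrix.mul_smul, mul_vecMulVec, hw, trace_smul,
    trace_vecMulVec, smul_dotProduct, dotProduct_comm,
    outputVec_dotProduct dE (conjTranspose_clockShift_mul_self d ij.1 ij.2)]
  simp only [smul_eq_mul]
  field_simp

/-- The maximal success probability for discriminating the uniform ensemble of
the `d²` clock-shift unitary channels using memory-`d_E` single-copy testers equals
`min {1, d_E/d}`. -/
theorem clock_shift_memory_dependence (d : ℕ) [NeZero d] (dE : ℕ) (hdE : 1 ≤ dE) :
    IsGreatest
      {p : ℝ | ∃ (ρ : Matrix (Fin d × Fin dE) (Fin d × Fin dE) ℂ)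
          (M : Fin d × Fin d → Matrix (Fin dE × Fin d) (Fin dE × Fin d) ℂ),
          IsState ρ ∧ IsPOVM M ∧
          (p : ℂ) = (1 / (d : ℂ) ^ 2) *
            ∑ ij : Fin d × Fin d,
              Matrix.trace (linkE ρ (M ij)ᵀ * choiU (clockShift d ij.1 ij.2))}
      (min 1 ((dE : ℝ) / d)) := by
  have hd : (d : ℝ) ≠ 0 := Nat.cast_ne_zero.mpr (NeZero.ne d)
  have hdC : (d : ℂ) ≠ 0 := Nat.cast_ne_zero.mpr (NeZero.ne d)
  have hpos : (0 : ℝ) < d := by positivity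
  refine ⟨⟨entangledState d dE, outputPOVM d dE, isState_entangledState d hdE,
    isPOVM_outputPOVM d dE, ?_⟩, ?_⟩
  · have hmin : min 1 ((dE : ℝ) / d) = (min d dE : ℕ) / (d : ℝ) := by
      rw [Nat.cast_min, ← min_div_div_right hpos.le, div_self hd]
    simp_rw [trace_linkE_mul_choiU, trace_outputPOVM_mul d hdE]
    rw [hmin, Complex.ofReal_div, Complex.ofReal_natCast, Complex.ofReal_natCast]
    simp only [Finset.sum_const, Finset.card_univ, Fintype.card_prod, Fintype.card_fin,
      nsmul_eq_mul, Nat.cast_mul]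
    field_simp
  · rintro p ⟨ρ, M, hρ, hM, hp⟩
    simp_rw [trace_linkE_mul_choiU] at hp
    have hσ (ij : Fin d × Fin d) := hρ.conjLift_mul_mul
      (conjTranspose_clockShift_mul_self d ij.1 ij.2)
    have h1 := Finset.sum_le_sum fun ij (_ : ij ∈ Finset.univ) => hM.trace_mul_le_one ij (hσ ij)
    have h2 := Finset.sum_le_sum fun ij (_ : ij ∈ Finset.univ) =>
      trace_mul_le_trace_left (hM.1 ij) (hσ ij)
    rw [hM.sum_trace] at h2
    have hS := (eq_div_iff (pow_ne_zero 2 hdC)).mp (hp.trans (one_div_mul_eq_div _ _))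
    rw [← hS] at h1 h2
    simp only [Finset.sum_const, Finset.card_univ, Fintype.card_prod, Fintype.card_fin,
      nsmul_eq_mul, mul_one] at h1 h2
    have h1' : p * (d : ℝ) ^ 2 ≤ d * d := by exact_mod_cast h1
    have h2' : p * (d : ℝ) ^ 2 ≤ dE * d := by exact_mod_cast h2
    refine le_min ?_ ?_
    · nlinarith [mul_pos hpos hpos]
    · rw [le_div_iff₀ hpos]
      nlinarith
end
end

section
/- A single-copy tester {T^i}_{i=1}^N on ℂ^{d_I}⊗ℂ^{d_O} is a convex combination of memory-less single-copy testers if and only if for every k ∈ ℕ there exists a single-copy tester {T_k^i}_{i=1}^N on (ℂ^{d_I})^{⊗k}⊗ℂ^{d_O} whose elements are supported on Sym^k(ℂ^{d_I})⊗ℂ^{d_O} (the symmetric subspace of the k input copies, tensored with the output) and which satisfies T^i = Tr_{I^{k−1}}(T_k^i) for all i, where Tr_{I^{k−1}} denotes the partial trace over all but one of the k input copies. -/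
open Matrix BigOperators ComplexOrder

noncomputable section

/-- A single-copy tester on `A ⊗ B` (with input system `A` and output system `B`):
a family realized as `T^i = ρ_{AE} * (M^i_{EB})ᵀ` for some memory dimension `d_E ≥ 1`,
a state `ρ_{AE}` and a POVM `{M^i_{EB}}`. -/
def IsTester {A B : Type*} [Fintype A] [DecidableEq A] [Fintype B] [DecidableEq B]
    {N : ℕ} (T : Fin N → Matrix (A × B) (A × B) ℂ) : Prop :=
  ∃ (dE : ℕ), 1 ≤ dE ∧
    ∃ (ρ : Matrix (A × Fin dE) (A × Fin dE) ℂ)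
      (M : Fin N → Matrix (Fin dE × B) (Fin dE × B) ℂ),
      IsState ρ ∧ IsPOVM M ∧ ∀ i, T i = linkE ρ (M i)ᵀ

/-- A convex combination of memory-less single-copy testers:
`T^i = ∑_λ p_λ ρ^λ ⊗ (M^{i|λ})` with states `ρ^λ` and POVMs `{M^{i|λ}}_i`.
(For memory-less testers the link product reduces to the tensor product, the transpose of the
POVM element on the trivial memory system being the matrix itself after suitable convention;
here we follow `T^i = ρ ⊗ M^i` with the POVM acting on the output system.) -/
def IsConvexCombMemoryless {dI dO N : ℕ}
    (T : Fin N → Matrix (Fin dI × Fin dO) (Fin dI × Fin dO) ℂ) : Prop :=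
  ∃ (L : ℕ) (p : Fin L → ℝ) (ρ : Fin L → Matrix (Fin dI) (Fin dI) ℂ)
    (M : Fin L → Fin N → Matrix (Fin dO) (Fin dO) ℂ),
    (∀ l, 0 ≤ p l) ∧ (∑ l, p l = 1) ∧
    (∀ l, IsState (ρ l)) ∧ (∀ l, IsPOVM (M l)) ∧
    ∀ i, T i = ∑ l, (p l : ℂ) • Matrix.kroneckerMap (· * ·) (ρ l) (M l i)

open ComplexConjugate in
/-- A finite set of phases that is orthogonal for all monomials of degree at most `m`. -/
lemma exists_phases (m : ℕ) : ∃ (q : ℕ) (ζ : Fin q → ℂ), 0 < q ∧ ∀ a b : ℕ, a ≤ m → b ≤ m →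
    ∑ t, ζ t ^ a * conj (ζ t) ^ b = if a = b then (q : ℂ) else 0 := by
  have hη := Complex.isPrimitiveRoot_exp (m + 1) m.succ_ne_zero
  set η := Complex.exp (2 * Real.pi * Complex.I / (m + 1 : ℕ))
  have hnorm : ‖η‖ = 1 := hη.norm'_eq_one m.succ_ne_zero
  have hconj : η * conj η = 1 := by
    rw [Complex.mul_conj, Complex.normSq_eq_norm_sq, hnorm]; simp
  refine ⟨m + 1, fun t => η ^ (t : ℕ), m.succ_pos, fun a b ha hb => ?_⟩
  have hterm : ∀ t : Fin (m + 1), (η ^ (t : ℕ)) ^ a * conj (η ^ (t : ℕ)) ^ b =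
      (η ^ a * conj η ^ b) ^ (t : ℕ) := by
    intro t
    rw [map_pow, mul_pow, ← pow_mul, ← pow_mul, ← pow_mul, ← pow_mul, mul_comm a, mul_comm b]
  simp_rw [hterm]
  rw [Fin.sum_univ_eq_sum_range (fun t => (η ^ a * conj η ^ b) ^ t) (m + 1)]
  split_ifs with hab
  · subst hab
    simp [← mul_pow, hconj]
  · have hw : η ^ a * conj η ^ b ≠ 1 := by
      intro h
      apply hab
      refine hη.pow_inj (by omega) (by omega) ?_
      calc η ^ a = η ^ a * conj η ^ b * η ^ b := by
            rw [mul_assoc, ← mul_pow, mul_comm (conj η), hconj, one_pow, mul_one]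
        _ = η ^ b := by rw [h, one_mul]
    have hpow : (η ^ a * conj η ^ b) ^ (m + 1) = 1 := by
      rw [mul_pow, ← pow_mul, ← pow_mul, mul_comm a, mul_comm b, pow_mul, pow_mul, ← map_pow,
        hη.pow_eq_one]
      simp
    have := geom_sum_mul (η ^ a * conj η ^ b) (m + 1)
    rw [hpow, sub_self] at this
    exact (mul_eq_zero.mp this).resolve_right (sub_ne_zero.mpr hw)

section Moments

variable {α : Type*} [Fintype α] [DecidableEq α] {m : ℕ}

/-- The number of positions at which the word `F` takes the value `c`. -/
def letterCount (F : Fin m → α) (c : α) : ℕ := Fintype.card {j // F j = c}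

lemma letterCount_le {β : Type*} [DecidableEq β] (F : Fin m → β) (c : β) : letterCount F c ≤ m := by
  simpa [letterCount] using Fintype.card_subtype_le (fun j => F j = c)

lemma prod_word (F : Fin m → α) (z : α → ℂ) : ∏ j, z (F j) = ∏ c, z c ^ letterCount F c := by
  rw [← Finset.prod_fiberwise' Finset.univ F z]
  refine Finset.prod_congr rfl fun c _ => ?_
  rw [Finset.prod_const, letterCount, Fintype.card_subtype]

lemma card_perm_comp_eq (F H : Fin m → α) :
    Fintype.card {τ : Equiv.Perm (Fin m) // F ∘ τ = H} =
      if letterCount F = letterCount H then ∏ c, (letterCount F c).factorial else 0 := by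
  split_ifs with h
  · have e : ∀ c, {j // H j = c} ≃ {j // F j = c} := fun c =>
      Fintype.equivOfCardEq (congrFun h c).symm
    have hσ : F ∘ Equiv.ofFiberEquiv e = H := funext fun j => Equiv.ofFiberEquiv_map e j
    set σ : Equiv.Perm (Fin m) := Equiv.ofFiberEquiv e
    have hs := DomMulAct.stabilizer_card F
    unfold letterCount
    rw [← hs]
    refine Fintype.card_congr ((Equiv.mulRight σ⁻¹).subtypeEquiv fun τ => ?_)
    constructor
    · intro hτ
      funext j
      have := congrFun (hτ.trans hσ.symm) (σ⁻¹ j)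
      simpa using this
    · intro hτ
      rw [← hσ]
      funext j
      have := congrFun hτ (σ j)
      simpa using this
  · rw [Fintype.card_eq_zero_iff]
    refine ⟨fun ⟨τ, hτ⟩ => h ?_⟩
    funext c
    subst hτ
    exact Fintype.card_congr (τ.symm.subtypeEquiv fun j => by simp)

open ComplexConjugate in
lemma re_phase_average_nonneg (V : (Fin m → α) → (Fin m → α) → ℂ)
    (hV : ∀ z : α → ℂ, 0 ≤ (∑ F, ∑ H, (∏ j, z (F j)) * conj (∏ j, z (H j)) * V F H).re)
    (r : α → ℝ) (hr : ∀ c, 0 ≤ r c) :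
    0 ≤ ∑ F, ∑ H, (if letterCount F = letterCount H then ∏ c, r c ^ letterCount F c else 0) *
      (V F H).re := by
  obtain ⟨q, ζ, hq, hζ⟩ := exists_phases m
  have key : ∀ F H : Fin m → α,
      ∑ θ : α → Fin q, (∏ j, (Real.sqrt (r (F j)) * ζ (θ (F j)) : ℂ)) *
        conj (∏ j, (Real.sqrt (r (H j)) * ζ (θ (H j)) : ℂ)) =
      (q : ℂ) ^ Fintype.card α *
        ((if letterCount F = letterCount H then ∏ c, r c ^ letterCount F c else 0 : ℝ) : ℂ) := by
    intro F H
    calc _ = ∑ θ : α → Fin q, ∏ c, (Real.sqrt (r c) * ζ (θ c) : ℂ) ^ letterCount F c *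
            conj (Real.sqrt (r c) * ζ (θ c) : ℂ) ^ letterCount H c := by
          refine Finset.sum_congr rfl fun θ _ => ?_
          rw [prod_word F (fun c => (Real.sqrt (r c) * ζ (θ c) : ℂ)),
            prod_word H (fun c => (Real.sqrt (r c) * ζ (θ c) : ℂ)), map_prod,
            ← Finset.prod_mul_distrib]
          simp only [map_pow]
      _ = ∏ c, ∑ t, (Real.sqrt (r c) * ζ t : ℂ) ^ letterCount F c *
            conj (Real.sqrt (r c) * ζ t : ℂ) ^ letterCount H c := by
          rw [Finset.prod_univ_sum, Fintype.piFinset_univ]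
      _ = ∏ c, if letterCount F c = letterCount H c then
            (q : ℂ) * (r c : ℂ) ^ letterCount F c else 0 := by
          refine Finset.prod_congr rfl fun c _ => ?_
          have : ∀ t, (Real.sqrt (r c) * ζ t : ℂ) ^ letterCount F c *
              conj (Real.sqrt (r c) * ζ t : ℂ) ^ letterCount H c =
              (Real.sqrt (r c) : ℂ) ^ (letterCount F c + letterCount H c) *
                (ζ t ^ letterCount F c * conj (ζ t) ^ letterCount H c) := by
            intro t
            rw [map_mul, Complex.conj_ofReal]; ring
          simp_rw [this]
          rw [← Finset.mul_sum, hζ _ _ (letterCount_le F c) (letterCount_le H c)]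
          split_ifs with h
          · rw [← h, ← two_mul, pow_mul, ← Complex.ofReal_pow (Real.sqrt (r c)),
              Real.sq_sqrt (hr c), mul_comm]
          · simp
      _ = _ := by
          split_ifs with h
          · simp_rw [h]
            rw [← Finset.card_univ, ← Finset.prod_const]
            simp [Finset.prod_mul_distrib]
          · obtain ⟨c, hc⟩ := Function.ne_iff.mp h
            rw [Finset.prod_eq_zero (Finset.mem_univ c) (by simp [hc])]
            simp
  have hsum := Finset.sum_nonneg fun (θ : α → Fin q) (_ : θ ∈ Finset.univ) =>
    hV fun c => Real.sqrt (r c) * ζ (θ c)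
  rw [← Complex.re_sum, Finset.sum_comm] at hsum
  simp_rw [Finset.sum_comm (s := (Finset.univ : Finset (α → Fin q))), ← Finset.sum_mul, key,
    mul_assoc, ← Finset.mul_sum] at hsum
  rw [← Complex.ofReal_natCast, ← Complex.ofReal_pow, Complex.re_ofReal_mul] at hsum
  have := nonneg_of_mul_nonneg_right hsum (by positivity)
  simpa [Complex.re_sum, Complex.re_ofReal_mul] using this

open MeasureTheory Set in
lemma factorial_moment (a : ℕ) :
    Integrable (fun r : ℝ => (Ioi (0 : ℝ)).indicator (fun r => Real.exp (-r) * r ^ a) r) ∧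
    ∫ r : ℝ, (Ioi (0 : ℝ)).indicator (fun r => Real.exp (-r) * r ^ a) r = a.factorial := by
  constructor
  · rw [integrable_indicator_iff measurableSet_Ioi]
    have := Real.GammaIntegral_convergent (s := a + 1) (by positivity)
    simpa using this
  · rw [integral_indicator measurableSet_Ioi, ← Real.Gamma_nat_eq_factorial,
      Real.Gamma_eq_integral (by positivity)]
    simp

open MeasureTheory Set in
lemma sum_factorial_nonneg_of_sum_pow_nonneg {β κ : Type*} [Fintype β] [Fintype κ]
    (a : κ → β → ℕ) (w : κ → ℝ)
    (h : ∀ r : β → ℝ, (∀ c, 0 ≤ r c) → 0 ≤ ∑ s, (∏ c, r c ^ a s c) * w s) :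
    0 ≤ ∑ s, (∏ c, ((a s c).factorial : ℝ)) * w s := by
  let g : ℕ → ℝ → ℝ := fun n => (Ioi (0 : ℝ)).indicator (fun r => Real.exp (-r) * r ^ n)
  have hint : ∀ s, Integrable (fun r : β → ℝ => ∏ c, g (a s c) (r c)) := fun s =>
    Integrable.fintype_prod (f := fun c => g (a s c)) fun c => (factorial_moment (a s c)).1
  have hval : ∀ s, ∫ r : β → ℝ, ∏ c, g (a s c) (r c) = ∏ c, ((a s c).factorial : ℝ) := by
    intro s
    rw [integral_fintype_prod_volume_eq_prod (fun c => g (a s c))]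
    exact Finset.prod_congr rfl fun c _ => (factorial_moment (a s c)).2
  simp_rw [← hval, ← integral_mul_const]
  rw [← integral_finsetSum _ fun s _ => (hint s).mul_const (w s)]
  refine integral_nonneg fun r => ?_
  change 0 ≤ ∑ s, (∏ c, g (a s c) (r c)) * w s
  by_cases hr : ∀ c, 0 < r c
  · have : ∀ s, (∏ c, g (a s c) (r c)) * w s =
        (∏ c, Real.exp (-r c)) * ((∏ c, r c ^ a s c) * w s) := by
      intro s
      rw [← mul_assoc, ← Finset.prod_mul_distrib]
      simp [g, hr]
    simp_rw [this, ← Finset.mul_sum]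
    exact mul_nonneg (Finset.prod_nonneg fun c _ => (Real.exp_pos _).le)
      (h r fun c => (hr c).le)
  · push Not at hr
    obtain ⟨c, hc⟩ := hr
    refine (Finset.sum_eq_zero fun s _ => ?_).ge
    rw [Finset.prod_eq_zero (Finset.mem_univ c) (by simp [g, hc]), zero_mul]

open ComplexConjugate in
/-- Gaussian moments of a nonnegative polynomial: if the sesquilinear form `V` is nonnegative on all
product vectors `z ⊗ ⋯ ⊗ z`, then so is its pairing with the sum of all permutation operators. -/
lemma re_sum_perm_nonneg (V : (Fin m → α) → (Fin m → α) → ℂ)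
    (hV : ∀ z : α → ℂ, 0 ≤ (∑ F, ∑ H, (∏ j, z (F j)) * conj (∏ j, z (H j)) * V F H).re) :
    0 ≤ (∑ τ : Equiv.Perm (Fin m), ∑ F, V F (F ∘ τ)).re := by
  have h := sum_factorial_nonneg_of_sum_pow_nonneg
    (fun s : (Fin m → α) × (Fin m → α) => letterCount s.1)
    (fun s => if letterCount s.1 = letterCount s.2 then (V s.1 s.2).re else 0) ?_
  · convert h using 1
    rw [Fintype.sum_prod_type, Finset.sum_comm, Complex.re_sum]
    refine Finset.sum_congr rfl fun F _ => ?_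
    have hF : ∑ τ : Equiv.Perm (Fin m), V F (F ∘ τ) =
        ∑ H, (Fintype.card {τ : Equiv.Perm (Fin m) // F ∘ τ = H} : ℂ) * V F H := by
      rw [← Finset.sum_fiberwise Finset.univ (fun τ : Equiv.Perm (Fin m) => F ∘ τ)]
      refine Finset.sum_congr rfl fun H _ => ?_
      rw [Finset.sum_congr rfl (g := fun _ => V F H)
        fun τ hτ => by rw [(Finset.mem_filter.mp hτ).2]]
      rw [Finset.sum_const, Fintype.card_subtype, nsmul_eq_mul]
    rw [hF, Complex.re_sum]
    refine Finset.sum_congr rfl fun H _ => ?_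
    rw [card_perm_comp_eq, ← Complex.ofReal_natCast, Complex.re_ofReal_mul]
    split_ifs <;> simp
  · intro r hr
    have := re_phase_average_nonneg V hV r hr
    rw [Fintype.sum_prod_type]
    simpa [ite_mul, mul_ite] using this

end Moments

section PosSemidef

variable {P E : Type*} [Fintype P] [Fintype E]

lemma Matrix.PosSemidef.exists_eq_conjTranspose_mul_self {A : Matrix P P ℂ} (hA : A.PosSemidef) :
    ∃ B : Matrix P P ℂ, A = Bᴴ * B := by
  classical
  open scoped MatrixOrder in
  exact CStarAlgebra.nonneg_iff_eq_star_mul_self.mp hA.nonneg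

open ComplexConjugate in
/-- Sandwiching the second factor of a positive semidefinite matrix with a vector. -/
lemma Matrix.PosSemidef.contract {X : Matrix (P × E) (P × E) ℂ} (hX : X.PosSemidef) (w : E → ℂ) :
    (Matrix.of fun p q => ∑ f, ∑ e, conj (w f) * X (p, f) (q, e) * w e).PosSemidef := by
  classical
  convert hX.conjTranspose_mul_mul_same
    (Matrix.of fun (s : P × E) (q : P) => if s.1 = q then w s.2 else 0) using 1
  ext p q
  simp only [Matrix.of_apply, Matrix.mul_apply, Matrix.conjTranspose_apply, Fintype.sum_prod_type]
  rw [Finset.sum_comm]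
  simp [apply_ite, Finset.sum_mul, ite_mul]

lemma Matrix.PosSemidef.blockDiagonal [DecidableEq E] {σ : E → Matrix P P ℂ}
    (hσ : ∀ e, (σ e).PosSemidef) :
    (Matrix.blockDiagonal σ).PosSemidef := by
  choose B hB using fun e => (hσ e).exists_eq_conjTranspose_mul_self
  rw [show σ = fun e => (B e)ᴴ * B e from funext hB, Matrix.blockDiagonal_mul,
    ← Matrix.blockDiagonal_conjTranspose]
  exact Matrix.posSemidef_conjTranspose_mul_self _

end PosSemidef

section Testers

variable {A B : Type*} [Fintype A] [DecidableEq A] [Fintype B] [DecidableEq B] {N : ℕ}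

lemma IsTester.posSemidef {T : Fin N → Matrix (A × B) (A × B) ℂ} (hT : IsTester T) (i : Fin N) :
    (T i).PosSemidef := by
  obtain ⟨dE, -, ρ, M, hρ, hM, hTi⟩ := hT
  have h := ((hρ.1.kronecker (hM.1 i).transpose).submatrix
    fun s : (A × B) × Fin dE => ((s.1.1, s.2), (s.2, s.1.2))).contract fun _ => 1
  rw [hTi i]
  convert h using 1
  ext p q
  simp only [linkE, Matrix.of_apply, map_one, one_mul, mul_one, Matrix.submatrix_apply,
    Matrix.kroneckerMap_apply]
  rw [Finset.sum_comm]

lemma IsTester.exists_sum_eq {T : Fin N → Matrix (A × B) (A × B) ℂ} (hT : IsTester T) :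
    ∃ σ : Matrix A A ℂ, IsState σ ∧
      ∀ a a' b b', ∑ i, T i (a, b) (a', b') = σ a a' * (1 : Matrix B B ℂ) b b' := by
  obtain ⟨dE, -, ρ, M, hρ, hM, hTi⟩ := hT
  refine ⟨Matrix.of fun a a' => ∑ e, ρ (a, e) (a', e), ⟨?_, ?_⟩, fun a a' b b' => ?_⟩
  · have h : ∀ e, (Matrix.of fun a a' => ρ (a, e) (a', e)).PosSemidef := fun e =>
      hρ.1.submatrix fun a => (a, e)
    convert Matrix.posSemidef_sum Finset.univ fun e _ => h e using 1
    ext a a'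
    simp [Matrix.sum_apply]
  · simpa [Matrix.trace, Fintype.sum_prod_type] using hρ.2
  · have hsum : ∀ f e, ∑ i, M i (e, b') (f, b) = (1 : Matrix (Fin dE × B) (Fin dE × B) ℂ)
        (e, b') (f, b) := fun f e => by rw [← hM.2, Matrix.sum_apply]
    simp only [hTi, linkE, Matrix.of_apply, Matrix.transpose_apply]
    rw [Finset.sum_comm]
    simp_rw [Finset.sum_comm (s := (Finset.univ : Finset (Fin N))), ← Finset.mul_sum, hsum]
    simp only [Matrix.one_apply, Prod.mk.injEq]
    by_cases hb : b = b'
    · simp [hb]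
    · simp [hb, Ne.symm hb]

/-- Testers whose memory is classical. -/
lemma isTester_of_classical_memory {Λ : Type*} [Fintype Λ] {σ : Λ → Matrix A A ℂ}
    {M : Λ → Fin N → Matrix B B ℂ} (hσ : ∀ l, (σ l).PosSemidef) (hσ1 : ∑ l, (σ l).trace = 1)
    (hM : ∀ l, IsPOVM (M l)) {T : Fin N → Matrix (A × B) (A × B) ℂ}
    (hT : ∀ i a b a' b', T i (a, b) (a', b') = ∑ l, σ l a a' * M l i b b') :
    IsTester T := by
  let ε := Fintype.equivFin Λ
  let R : Matrix (A × Fin (Fintype.card Λ)) (A × Fin (Fintype.card Λ)) ℂ :=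
    Matrix.blockDiagonal fun e => σ (ε.symm e)
  let Q : Fin N → Matrix (Fin (Fintype.card Λ) × B) (Fin (Fintype.card Λ) × B) ℂ := fun i =>
    ((Matrix.blockDiagonal fun e => M (ε.symm e) i).submatrix Prod.swap Prod.swap)ᵀ
  refine ⟨Fintype.card Λ, ?_, R, Q, ⟨Matrix.PosSemidef.blockDiagonal fun e => hσ _, ?_⟩,
    ⟨fun i => ((Matrix.PosSemidef.blockDiagonal fun e => (hM _).1 i).submatrix _).transpose,
      ?_⟩, fun i => ?_⟩
  · rw [Nat.one_le_iff_ne_zero]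
    intro h
    have := Fintype.card_eq_zero_iff.mp h
    simp at hσ1
  · rw [Matrix.trace_blockDiagonal, ← hσ1]
    exact ε.symm.sum_comp fun l => (σ l).trace
  · ext ⟨e, b⟩ ⟨e', b'⟩
    have h := congrFun (congrFun (hM (ε.symm e')).2 b') b
    rw [Matrix.sum_apply] at h
    simp only [Q, Matrix.sum_apply, Matrix.transpose_apply, Matrix.submatrix_apply, Prod.swap,
      Matrix.blockDiagonal_apply]
    by_cases he : e' = e
    · subst he
      simp [h, Matrix.one_apply, eq_comm]
    · simp [he, Ne.symm he]
  · ext ⟨a, b⟩ ⟨a', b'⟩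
    rw [hT, ← ε.symm.sum_comp]
    simp [linkE, R, Q, Matrix.blockDiagonal_apply, ite_mul]

end Testers

section ConvexHull

lemma IsCompact.convexHull_of_finiteDimensional {E : Type*} [NormedAddCommGroup E]
    [NormedSpace ℝ E] [FiniteDimensional ℝ E] {s : Set E} (hs : IsCompact s) :
    IsCompact (convexHull ℝ s) := by
  let n := Module.finrank ℝ E + 1
  have himage : convexHull ℝ s = (fun y : (Fin n → ℝ) × (Fin n → E) => ∑ j, y.1 j • y.2 j) ''
      (stdSimplex ℝ (Fin n) ×ˢ Set.univ.pi fun _ => s) := by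
    ext x
    constructor
    · intro hx
      obtain ⟨ι, _, z, w, hz, hind, hw, hw1, hwz⟩ := eq_pos_convex_span_of_mem_convexHull hx
      have hcard : Fintype.card ι ≤ Fintype.card (Fin n) := by
        rw [Fintype.card_fin]
        exact hind.card_le_finrank_succ.trans (Nat.succ_le_succ (Submodule.finrank_le _))
      obtain ⟨g⟩ := Function.Embedding.nonempty_of_card_le hcard
      have hne : Nonempty ι := by
        by_contra h
        rw [not_nonempty_iff] at h
        simp at hw1
      let i₀ := hne.some
      refine ⟨(Function.extend g w 0, Function.extend g z fun _ => z i₀), ⟨⟨?_, ?_⟩, ?_⟩, ?_⟩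
      · intro j
        by_cases hj : ∃ i, g i = j
        · obtain ⟨i, rfl⟩ := hj
          simpa [g.injective.extend_apply] using (hw i).le
        · simp [Function.extend_apply' _ _ _ hj]
      · rw [← hw1]
        refine (Fintype.sum_of_injective g g.injective _ _ (fun j hj => ?_) fun i => ?_).symm
        · simpa using Function.extend_apply' w (0 : Fin n → ℝ) j hj
        · simp [g.injective.extend_apply]
      · intro j _
        by_cases hj : ∃ i, g i = j
        · obtain ⟨i, rfl⟩ := hj
          simpa [g.injective.extend_apply] using hz ⟨i, rfl⟩
        · simpa [Function.extend_apply' _ _ _ hj] using hz ⟨i₀, rfl⟩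
      · rw [← hwz]
        refine (Fintype.sum_of_injective g g.injective _ _ (fun j hj => ?_) fun i => ?_).symm
        · have := Function.extend_apply' w (0 : Fin n → ℝ) j hj
          simp only [this, Pi.zero_apply, zero_smul]
        · simp [g.injective.extend_apply]
    · rintro ⟨⟨w, z⟩, ⟨hw, hz⟩, rfl⟩
      exact mem_convexHull_of_exists_fintype w z hw.1 hw.2 (fun i => hz i trivial) rfl
  rw [himage]
  refine ((isCompact_stdSimplex ℝ (Fin n)).prod (isCompact_univ_pi fun _ => hs)).image ?_
  fun_prop

end ConvexHull

section SymmetricExtension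

variable {dI dO N : ℕ}

open ComplexConjugate in
lemma sum_word_cons {c : ℝ} {k : ℕ} (v : Fin dI → ℂ) (x x' : Fin dI) :
    ∑ g : Fin k → Fin dI, ((c / (∑ y, ‖v y‖ ^ 2) ^ k : ℝ) : ℂ) *
      ((∏ j, v ((Fin.cons x g : Fin (k + 1) → Fin dI) j)) *
        conj (∏ j, v ((Fin.cons x' g : Fin (k + 1) → Fin dI) j))) = c * (v x * conj (v x')) := by
  have hpow : ∑ g : Fin k → Fin dI, (∏ j, v (g j)) * conj (∏ j, v (g j)) =
      (((∑ y, ‖v y‖ ^ 2) ^ k : ℝ) : ℂ) := by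
    rw [Fintype.sum_pow, Complex.ofReal_sum]
    refine Finset.sum_congr rfl fun g _ => ?_
    rw [map_prod, ← Finset.prod_mul_distrib, Complex.ofReal_prod]
    refine Finset.prod_congr rfl fun j _ => ?_
    rw [Complex.mul_conj, Complex.normSq_eq_norm_sq]
  have hterm : ∀ g : Fin k → Fin dI,
      ((c / (∑ y, ‖v y‖ ^ 2) ^ k : ℝ) : ℂ) *
      ((∏ j, v ((Fin.cons x g : Fin (k + 1) → Fin dI) j)) *
        conj (∏ j, v ((Fin.cons x' g : Fin (k + 1) → Fin dI) j))) =
      ((c / (∑ y, ‖v y‖ ^ 2) ^ k : ℝ) : ℂ) * (v x * conj (v x')) *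
        ((∏ j, v (g j)) * conj (∏ j, v (g j))) := by
    intro g
    simp only [Fin.prod_univ_succ, Fin.cons_zero, Fin.cons_succ, map_mul]
    ring
  simp_rw [hterm]
  rw [← Finset.mul_sum, hpow]
  by_cases hs : (∑ y, ‖v y‖ ^ 2) ^ k = 0
  · have hv : v x = 0 := by
      have h0 := (Finset.sum_eq_zero_iff_of_nonneg fun y _ => sq_nonneg ‖v y‖).mp
        (pow_eq_zero_iff (fun hk => by simp [hk] at hs) |>.mp hs)
        x (Finset.mem_univ x)
      simpa using h0
    simp [hv]
  · rw [mul_right_comm, ← Complex.ofReal_mul, div_mul_cancel₀ _ hs]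

open ComplexConjugate in
lemma IsConvexCombMemoryless.exists_symmetric_extension
    {T : Fin N → Matrix (Fin dI × Fin dO) (Fin dI × Fin dO) ℂ} (hT : IsConvexCombMemoryless T)
    (k : ℕ) :
    ∃ Tk : Fin N → Matrix ((Fin (k + 1) → Fin dI) × Fin dO) ((Fin (k + 1) → Fin dI) × Fin dO) ℂ,
      IsTester Tk ∧
      (∀ (i : Fin N) (σ σ' : Equiv.Perm (Fin (k + 1)))
          (f g : Fin (k + 1) → Fin dI) (o o' : Fin dO),
        Tk i (f ∘ σ, o) (g ∘ σ', o') = Tk i (f, o) (g, o')) ∧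
      (∀ (i : Fin N) (x x' : Fin dI) (o o' : Fin dO),
        T i (x, o) (x', o') = ∑ g : Fin k → Fin dI, Tk i (Fin.cons x g, o) (Fin.cons x' g, o')) := by
  obtain ⟨L, p, ρ, M, hp, hp1, hρ, hM, hTi⟩ := hT
  choose m v hv using fun l => Matrix.posSemidef_iff_eq_sum_vecMulVec.mp (hρ l).1
  have hρv : ∀ l x x', ρ l x x' = ∑ j, v l j x * conj (v l j x') := by
    intro l x x'
    conv_lhs => rw [hv l]
    simp [Matrix.sum_apply, Matrix.vecMulVec_apply]
  let c : (Σ l, Fin (m l)) → ℝ := fun s => p s.1 / (∑ y, ‖v s.1 s.2 y‖ ^ 2) ^ k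
  have hc : ∀ s, 0 ≤ c s := fun s =>
    div_nonneg (hp _) (pow_nonneg (Finset.sum_nonneg fun y _ => sq_nonneg _) _)
  let σ : (Σ l, Fin (m l)) → Matrix (Fin (k + 1) → Fin dI) (Fin (k + 1) → Fin dI) ℂ := fun s =>
    Matrix.of fun f g => (c s : ℂ) * ((∏ j, v s.1 s.2 (f j)) * conj (∏ j, v s.1 s.2 (g j)))
  have hσ : ∀ s x x', ∑ g : Fin k → Fin dI, σ s (Fin.cons x g) (Fin.cons x' g) =
      p s.1 * (v s.1 s.2 x * conj (v s.1 s.2 x')) := fun s x x' => sum_word_cons _ x x'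
  refine ⟨fun i => Matrix.of fun P Q => ∑ s, σ s P.1 Q.1 * M s.1 i P.2 Q.2,
    isTester_of_classical_memory (σ := σ) (M := fun s => M s.1) (fun s => ?_) ?_
      (fun s => hM s.1) fun i a b a' b' => rfl, ?_, ?_⟩
  · have h := (Matrix.posSemidef_vecMulVec_self_star
      (fun f : Fin (k + 1) → Fin dI => ∏ j, v s.1 s.2 (f j))).smul
      (Complex.zero_le_real.mpr (hc s))
    convert h using 1
    ext f g
    simp [σ, Matrix.vecMulVec_apply]
  · have htr : ∀ s, (σ s).trace = ∑ x, (p s.1 : ℂ) * (v s.1 s.2 x * conj (v s.1 s.2 x)) := by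
      intro s
      rw [Matrix.trace, ← (Fin.consEquiv fun _ => Fin dI).sum_comp, Fintype.sum_prod_type]
      exact Finset.sum_congr rfl fun x _ => hσ s x x
    simp_rw [htr, Fintype.sum_sigma]
    calc _ = ∑ l, (p l : ℂ) * (ρ l).trace := by
          refine Finset.sum_congr rfl fun l _ => ?_
          rw [Finset.sum_comm]
          simp only [Matrix.trace, Matrix.diag_apply, hρv, Finset.mul_sum]
      _ = 1 := by
          simp_rw [(hρ _).2, mul_one]
          exact_mod_cast hp1
  · intro i τ τ' f g o o'
    simp only [Matrix.of_apply, σ, Function.comp_apply]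
    refine Finset.sum_congr rfl fun s _ => ?_
    rw [Equiv.prod_comp τ fun j => v s.1 s.2 (f j), Equiv.prod_comp τ' fun j => v s.1 s.2 (g j)]
  · intro i x x' o o'
    simp only [Matrix.of_apply]
    rw [Finset.sum_comm]
    simp_rw [← Finset.sum_mul, hσ, Fintype.sum_sigma, hTi, Matrix.sum_apply, Matrix.smul_apply,
      Matrix.kroneckerMap_apply, hρv, smul_eq_mul]
    refine Finset.sum_congr rfl fun l _ => ?_
    rw [Finset.sum_mul, Finset.mul_sum]
    exact Finset.sum_congr rfl fun j _ => (mul_assoc _ _ _).symm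

open ComplexConjugate in
/-- Memory-less testers with a pure input state, as entry functions. -/
def pureMemoryless (dI dO N : ℕ) : Set (Fin N → Fin dI × Fin dO → Fin dI × Fin dO → ℂ) :=
  {T | ∃ (ψ : Fin dI → ℂ) (M : Fin N → Matrix (Fin dO) (Fin dO) ℂ), ∑ x, ‖ψ x‖ ^ 2 = 1 ∧
    IsPOVM M ∧ T = fun i p q => ψ p.1 * conj (ψ q.1) * M i p.2 q.2}

open ComplexConjugate in
lemma isCompact_pureMemoryless : IsCompact (pureMemoryless dI dO N) := by
  let K : Set ((Fin dI → ℂ) × (Fin N → Fin dO → Fin dO → ℂ)) :=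
    {y | ∑ x, ‖y.1 x‖ ^ 2 = 1 ∧ ∀ o o', ∑ i, ∑ t, conj (y.2 i t o) * y.2 i t o' =
      (1 : Matrix (Fin dO) (Fin dO) ℂ) o o'}
  have hclosed : IsClosed K := by
    refine IsClosed.and (isClosed_eq (by fun_prop) (by fun_prop)) ?_
    simp only [Set.ofPred_forall]
    refine isClosed_iInter fun o => isClosed_iInter fun o' => isClosed_eq ?_ (by fun_prop)
    fun_prop
  have hbdd : K ⊆ Metric.closedBall 0 1 := by
    rintro ⟨ψ, B⟩ ⟨hψ, hB⟩
    rw [mem_closedBall_zero_iff, Prod.norm_mk, max_le_iff]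
    constructor
    · refine (pi_norm_le_iff_of_nonneg zero_le_one).mpr fun x => ?_
      rw [← sq_le_one_iff₀ (norm_nonneg _), ← hψ]
      exact Finset.single_le_sum (f := fun x => ‖ψ x‖ ^ 2) (fun _ _ => sq_nonneg _)
        (Finset.mem_univ x)
    · refine (pi_norm_le_iff_of_nonneg zero_le_one).mpr fun i =>
        (pi_norm_le_iff_of_nonneg zero_le_one).mpr fun t =>
        (pi_norm_le_iff_of_nonneg zero_le_one).mpr fun o => ?_
      have h1 : ∑ i, ∑ t, ‖B i t o‖ ^ 2 = 1 := by
        have h := hB o o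
        simp only [Complex.conj_mul', Matrix.one_apply_eq] at h
        exact_mod_cast h
      rw [← sq_le_one_iff₀ (norm_nonneg _), ← h1]
      refine le_trans ?_ (Finset.single_le_sum (f := fun i => ∑ t, ‖B i t o‖ ^ 2)
        (fun _ _ => Finset.sum_nonneg fun _ _ => sq_nonneg _) (Finset.mem_univ i))
      exact Finset.single_le_sum (f := fun t => ‖B i t o‖ ^ 2) (fun _ _ => sq_nonneg _)
        (Finset.mem_univ t)
  have hK : IsCompact K := (isCompact_closedBall 0 1).of_isClosed_subset hclosed hbdd
  have himage : pureMemoryless dI dO N = (fun y i p q => y.1 p.1 * conj (y.1 q.1) *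
      ∑ t, conj (y.2 i t p.2) * y.2 i t q.2) '' K := by
    ext T
    constructor
    · rintro ⟨ψ, M, hψ, hM, rfl⟩
      choose B hB using fun i => (hM.1 i).exists_eq_conjTranspose_mul_self
      have hBe : ∀ i o o', M i o o' = ∑ t, conj (B i t o) * B i t o' := fun i o o' => by
        rw [hB i, Matrix.mul_apply]; rfl
      refine ⟨(ψ, B), ⟨hψ, fun o o' => ?_⟩, ?_⟩
      · simp only [← hBe]
        rw [← hM.2, Matrix.sum_apply]
      · simp only [hBe]
    · rintro ⟨⟨ψ, B⟩, ⟨hψ, hB⟩, rfl⟩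
      refine ⟨ψ, fun i => (Matrix.of (B i))ᴴ * Matrix.of (B i), hψ,
        ⟨fun i => Matrix.posSemidef_conjTranspose_mul_self _, ?_⟩, ?_⟩
      · ext o o'
        rw [← hB, Matrix.sum_apply]
        rfl
      · rfl
  rw [himage]
  refine hK.image ?_
  fun_prop

lemma isConvexCombMemoryless_of_mem_convexHull
    {T : Fin N → Matrix (Fin dI × Fin dO) (Fin dI × Fin dO) ℂ}
    (hT : (T : Fin N → Fin dI × Fin dO → Fin dI × Fin dO → ℂ) ∈
      convexHull ℝ (pureMemoryless dI dO N)) :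
    IsConvexCombMemoryless T := by
  obtain ⟨κ, _, w, z, hw, hw1, hz, hwz⟩ := mem_convexHull_iff_exists_fintype.mp hT
  choose ψ M hψ hM hzi using hz
  let ε := (Fintype.equivFin κ).symm
  refine ⟨Fintype.card κ, w ∘ ε, fun l => Matrix.vecMulVec (ψ (ε l)) (star (ψ (ε l))),
    M ∘ ε, fun l => hw _, (ε.sum_comp w).trans hw1,
    fun l => ⟨Matrix.posSemidef_vecMulVec_self_star _, ?_⟩, fun l => hM _, fun i => ?_⟩
  · rw [Matrix.trace]
    simp only [Matrix.diag_apply, Matrix.vecMulVec_apply, Pi.star_apply]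
    have h := hψ (ε l)
    simp only [RCLike.star_def, Complex.mul_conj']
    exact_mod_cast h
  · ext P Q
    have h := congrFun (congrFun (congrFun hwz i) P) Q
    rw [← h, Matrix.sum_apply, ← ε.sum_comp]
    simp only [hzi, Finset.sum_apply, Matrix.sum_apply]
    refine Finset.sum_congr rfl fun c _ => ?_
    simp only [Function.comp_apply, Matrix.smul_apply, Matrix.kroneckerMap_apply,
      Matrix.vecMulVec_apply, Pi.star_apply, smul_eq_mul]
    exact Complex.real_smul

open ComplexConjugate in
lemma re_apply_nonpos_of_sum_eq_smul_one [Nonempty (Fin dO)]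
    (φ : (Fin N → Fin dI × Fin dO → Fin dI × Fin dO → ℂ) →ₗ[ℂ] ℂ)
    (hφ : ∀ X ∈ pureMemoryless dI dO N, (φ X).re ≤ 0) (z : Fin dI → ℂ)
    {M : Fin N → Matrix (Fin dO) (Fin dO) ℂ} (hM : ∀ i, (M i).PosSemidef) {p : ℂ}
    (hp : ∑ i, M i = p • (1 : Matrix (Fin dO) (Fin dO) ℂ)) :
    (φ fun i P Q => z P.1 * conj (z Q.1) * M i P.2 Q.2).re ≤ 0 := by
  obtain ⟨o⟩ := ‹Nonempty (Fin dO)›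
  have hp0 : 0 ≤ p := by
    have h := (Matrix.posSemidef_sum Finset.univ fun i _ => hM i).diag_nonneg (i := o)
    rw [hp] at h
    simpa using h
  obtain ⟨q, hq, rfl⟩ : ∃ q : ℝ, 0 ≤ q ∧ (q : ℂ) = p :=
    ⟨p.re, (Complex.nonneg_iff.mp hp0).1, Complex.ext rfl (Complex.nonneg_iff.mp hp0).2⟩
  set s : ℝ := ∑ x, ‖z x‖ ^ 2 with hs
  have hs0 : 0 ≤ s := Finset.sum_nonneg fun x _ => sq_nonneg _
  rcases hs0.eq_or_lt with hs0 | hs0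
  · have hz : z = 0 := funext fun x => by
      have h := (Finset.sum_eq_zero_iff_of_nonneg fun x _ => sq_nonneg ‖z x‖).mp hs0.symm x
        (Finset.mem_univ x)
      simpa using h
    have h0 : (fun i P Q => z P.1 * conj (z Q.1) * M i P.2 Q.2 :
        Fin N → Fin dI × Fin dO → Fin dI × Fin dO → ℂ) = 0 := by
      funext i P Q
      simp [hz]
    rw [h0]
    simp
  rcases hq.eq_or_lt with hq | hq
  · have hM0 : ∀ i, M i = 0 := by
      have htr : ∑ i, (M i).trace = 0 := by
        rw [← Matrix.trace_sum, hp, ← hq]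
        simp
      intro i
      exact (hM i).trace_eq_zero_iff.mp
        ((Finset.sum_eq_zero_iff_of_nonneg fun i _ => (hM i).trace_nonneg).mp htr i
          (Finset.mem_univ i))
    have h0 : (fun i P Q => z P.1 * conj (z Q.1) * M i P.2 Q.2 :
        Fin N → Fin dI × Fin dO → Fin dI × Fin dO → ℂ) = 0 := by
      funext i P Q
      simp [hM0]
    rw [h0]
    simp
  have hsC : ((Real.sqrt s : ℝ) : ℂ) * (Real.sqrt s : ℝ) = (s : ℂ) := by
    rw [← Complex.ofReal_mul, Real.mul_self_sqrt hs0.le]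
  have hsne : ((Real.sqrt s : ℝ) : ℂ) ≠ 0 := by
    exact_mod_cast (Real.sqrt_pos.mpr hs0).ne'
  have hqne : (q : ℂ) ≠ 0 := by exact_mod_cast hq.ne'
  have hmem : (fun i P Q => z P.1 / (Real.sqrt s : ℝ) * conj (z Q.1 / (Real.sqrt s : ℝ)) *
      (((q⁻¹ : ℝ) : ℂ) • M i) P.2 Q.2) ∈ pureMemoryless dI dO N := by
    refine ⟨fun x => z x / (Real.sqrt s : ℝ), fun i => ((q⁻¹ : ℝ) : ℂ) • M i, ?_,
      ⟨fun i => (hM i).smul (Complex.zero_le_real.mpr (inv_nonneg.mpr hq.le)), ?_⟩, rfl⟩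
    · simp only [norm_div, div_pow, Complex.norm_real, Real.norm_eq_abs, sq_abs,
        Real.sq_sqrt hs0.le]
      rw [← Finset.sum_div, ← hs, div_self hs0.ne']
    · rw [← Finset.smul_sum, hp, smul_smul, ← Complex.ofReal_mul, inv_mul_cancel₀ hq.ne']
      simp
  have hscale : (fun i P Q => z P.1 * conj (z Q.1) * M i P.2 Q.2 :
      Fin N → Fin dI × Fin dO → Fin dI × Fin dO → ℂ) = ((s * q : ℝ) : ℂ) •
      (fun i P Q => z P.1 / (Real.sqrt s : ℝ) * conj (z Q.1 / (Real.sqrt s : ℝ)) *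
        (((q⁻¹ : ℝ) : ℂ) • M i) P.2 Q.2 :
          Fin N → Fin dI × Fin dO → Fin dI × Fin dO → ℂ) := by
    funext i P Q
    simp only [Pi.smul_apply, Matrix.smul_apply, smul_eq_mul, map_div₀, Complex.conj_ofReal]
    rw [Complex.ofReal_mul, ← hsC, Complex.ofReal_inv]
    field_simp
  rw [hscale, map_smul, smul_eq_mul, Complex.re_ofReal_mul]
  exact mul_nonpos_of_nonneg_of_nonpos (mul_nonneg hs0.le hq.le) (hφ _ hmem)

/-- Contracting a permutation-invariant kernel on `k + 1` positions with all permutations of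
`k + 2` positions, one of which is kept open. -/
lemma sum_perm_kernel {α : Type*} [Fintype α] [DecidableEq α] {k : ℕ}
    (K : (Fin (k + 1) → α) → (Fin (k + 1) → α) → ℂ)
    (hK : ∀ (σ σ' : Equiv.Perm (Fin (k + 1))) f g, K (f ∘ σ) (g ∘ σ') = K f g) (x x' : α) :
    ∑ τ : Equiv.Perm (Fin (k + 2)), ∑ F : Fin (k + 2) → α,
      (if F 0 = x ∧ (F ∘ τ) 0 = x' then K (Fin.tail (F ∘ τ)) (Fin.tail F) else 0) =
    ((k + 1).factorial : ℂ) * ((if x = x' then ∑ g, K g g else 0) +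
      (k + 1) * ∑ g : Fin k → α, K (Fin.cons x g) (Fin.cons x' g)) := by
  have hperm : ∀ (p : Fin (k + 2)) (e : Equiv.Perm (Fin (k + 1))),
      ∑ F : Fin (k + 2) → α, (if F 0 = x ∧ (F ∘ Equiv.Perm.decomposeFin.symm (p, e)) 0 = x'
        then K (Fin.tail (F ∘ Equiv.Perm.decomposeFin.symm (p, e))) (Fin.tail F) else 0) =
      ∑ g : Fin (k + 1) → α, if (Fin.cons x g : Fin (k + 2) → α) p = x'
        then K (Fin.tail ((Fin.cons x g : Fin (k + 2) → α) ∘ Equiv.swap 0 p)) g else 0 := by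
    intro p e
    have htail : ∀ F : Fin (k + 2) → α, Fin.tail (F ∘ Equiv.Perm.decomposeFin.symm (p, e)) =
        Fin.tail (F ∘ Equiv.swap 0 p) ∘ e := by
      intro F
      funext j
      simp [Fin.tail, Equiv.Perm.decomposeFin_symm_apply_succ]
    have hKe : ∀ F : Fin (k + 2) → α, K (Fin.tail (F ∘ Equiv.swap 0 p) ∘ e) (Fin.tail F) =
        K (Fin.tail (F ∘ Equiv.swap 0 p)) (Fin.tail F) := fun F =>
      hK e 1 (Fin.tail (F ∘ Equiv.swap 0 p)) (Fin.tail F)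
    simp only [htail, hKe, Function.comp_apply (x := (0 : Fin (k + 2))),
      Equiv.Perm.decomposeFin_symm_apply_zero]
    rw [← (Fin.consEquiv fun _ => α).sum_comp, Fintype.sum_prod_type, Finset.sum_comm]
    refine Finset.sum_congr rfl fun g _ => ?_
    rw [Finset.sum_eq_single x]
    · simp [Fin.consEquiv]
    · intro y _ hy
      simp [Fin.consEquiv, hy]
    · simp
  have hsucc : ∀ j : Fin (k + 1),
      (∑ g : Fin (k + 1) → α, if (Fin.cons x g : Fin (k + 2) → α) j.succ = x'
        then K (Fin.tail ((Fin.cons x g : Fin (k + 2) → α) ∘ Equiv.swap 0 j.succ)) g else 0) =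
      ∑ g : Fin k → α, K (Fin.cons x g) (Fin.cons x' g) := by
    intro j
    have htail : ∀ g : Fin (k + 1) → α,
        Fin.tail ((Fin.cons x (g ∘ Equiv.swap 0 j) : Fin (k + 2) → α) ∘ Equiv.swap 0 j.succ) =
          Function.update g 0 x ∘ Equiv.swap 0 j := by
      intro g
      funext i
      by_cases hi : i = j
      · subst hi
        simp [Fin.tail]
      · have h1 : Equiv.swap 0 j.succ i.succ = i.succ :=
          Equiv.swap_apply_of_ne_of_ne (Fin.succ_ne_zero i) (by simpa using hi)
        have h2 : Equiv.swap 0 j i ≠ 0 := by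
          intro h
          rw [Equiv.swap_apply_eq_iff, Equiv.swap_apply_left] at h
          exact hi h
        simp [Fin.tail, h1, Function.update_of_ne h2]
    rw [← (Equiv.arrowCongr (Equiv.swap 0 j) (Equiv.refl α)).sum_comp]
    have hcongr : ∀ g : Fin (k + 1) → α,
        Equiv.arrowCongr (Equiv.swap 0 j) (Equiv.refl α) g = g ∘ Equiv.swap 0 j := fun g => by
      funext i
      simp [Equiv.arrowCongr]
    simp only [hcongr, htail, hK, Fin.cons_succ, Function.comp_apply, Equiv.swap_apply_right]
    rw [← (Fin.consEquiv fun _ => α).sum_comp, Fintype.sum_prod_type, Finset.sum_comm]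
    refine Finset.sum_congr rfl fun g _ => ?_
    rw [Finset.sum_eq_single x']
    · simp [Fin.consEquiv, Fin.update_cons_zero]
    · intro y _ hy
      simp [Fin.consEquiv, hy]
    · simp
  rw [← Equiv.Perm.decomposeFin.symm.sum_comp, Fintype.sum_prod_type]
  simp_rw [hperm]
  rw [Fin.sum_univ_succ]
  simp only [Finset.sum_const, Finset.card_univ, Fintype.card_perm, Fintype.card_fin, hsucc,
    nsmul_eq_mul, Fin.cons_zero, Equiv.swap_self, Equiv.coe_refl, Function.comp_id, Fin.tail_cons]
  have h0 : (∑ g : Fin (k + 1) → α, if x = x' then K g g else 0) =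
      if x = x' then ∑ g, K g g else 0 := by
    split_ifs <;> simp
  rw [h0]
  push_cast
  ring

open ComplexConjugate in
lemma re_apply_symmetric_extension_nonpos [Nonempty (Fin dO)] {k : ℕ}
    {T : Fin N → Fin dI × Fin dO → Fin dI × Fin dO → ℂ}
    {Tk : Fin N → Matrix ((Fin (k + 1) → Fin dI) × Fin dO) ((Fin (k + 1) → Fin dI) × Fin dO) ℂ}
    (hTk : IsTester Tk)
    (hsym : ∀ (i : Fin N) (σ σ' : Equiv.Perm (Fin (k + 1)))
      (f g : Fin (k + 1) → Fin dI) (o o' : Fin dO),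
      Tk i (f ∘ σ, o) (g ∘ σ', o') = Tk i (f, o) (g, o'))
    (hmarg : ∀ (i : Fin N) (x x' : Fin dI) (o o' : Fin dO),
      T i (x, o) (x', o') = ∑ g : Fin k → Fin dI, Tk i (Fin.cons x g, o) (Fin.cons x' g, o'))
    (φ : (Fin N → Fin dI × Fin dO → Fin dI × Fin dO → ℂ) →ₗ[ℂ] ℂ)
    (hφ : ∀ X ∈ pureMemoryless dI dO N, (φ X).re ≤ 0) :
    (φ fun i P Q => if P.1 = Q.1 then ∑ y, T i (y, P.2) (y, Q.2) else 0).re +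
      (k + 1) * (φ T).re ≤ 0 := by
  let V : (Fin (k + 2) → Fin dI) → (Fin (k + 2) → Fin dI) →
      Fin N → Fin dI × Fin dO → Fin dI × Fin dO → ℂ := fun F H i P Q =>
    if F 0 = P.1 ∧ H 0 = Q.1 then Tk i (Fin.tail H, P.2) (Fin.tail F, Q.2) else 0
  have hpos : ∀ z : Fin dI → ℂ,
      (∑ F, ∑ H, (∏ j, z (F j)) * conj (∏ j, z (H j)) * φ (V F H)).re ≤ 0 := by
    intro z
    obtain ⟨σ, -, hσ⟩ := hTk.exists_sum_eq
    let M : Fin N → Matrix (Fin dO) (Fin dO) ℂ := fun i => Matrix.of fun o o' =>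
      ∑ f : Fin (k + 1) → Fin dI, ∑ g : Fin (k + 1) → Fin dI,
        conj (∏ j, z (f j)) * Tk i (f, o) (g, o') * ∏ j, z (g j)
    have hM : ∀ i, (M i).PosSemidef := fun i =>
      ((hTk.posSemidef i).submatrix Prod.swap).contract fun f => ∏ j, z (f j)
    have hMp : ∑ i, M i = (∑ f : Fin (k + 1) → Fin dI, ∑ g : Fin (k + 1) → Fin dI,
        conj (∏ j, z (f j)) * σ f g * ∏ j, z (g j)) • (1 : Matrix (Fin dO) (Fin dO) ℂ) := by
      ext o o'
      simp only [M, Matrix.sum_apply, Matrix.of_apply, Matrix.smul_apply, smul_eq_mul]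
      rw [Finset.sum_comm, Finset.sum_mul]
      refine Finset.sum_congr rfl fun f _ => ?_
      rw [Finset.sum_comm, Finset.sum_mul]
      refine Finset.sum_congr rfl fun g _ => ?_
      rw [← Finset.sum_mul, ← Finset.mul_sum, hσ]
      ring
    have h := re_apply_nonpos_of_sum_eq_smul_one φ hφ z hM hMp
    convert h using 2
    simp only [← smul_eq_mul (_ * _) (φ _), ← map_smul, ← map_sum]
    congr 1
    funext i P Q
    simp only [Finset.sum_apply, Pi.smul_apply, smul_eq_mul, V, M, Matrix.of_apply]
    rw [← (Fin.consEquiv fun _ => Fin dI).sum_comp, Fintype.sum_prod_type,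
      Finset.sum_eq_single P.1]
    · rw [Finset.sum_comm, ← (Fin.consEquiv fun _ => Fin dI).sum_comp, Fintype.sum_prod_type,
        Finset.sum_eq_single Q.1]
      · rw [Finset.mul_sum]
        refine Finset.sum_congr rfl fun f _ => ?_
        rw [Finset.mul_sum]
        refine Finset.sum_congr rfl fun g _ => ?_
        simp only [Fin.consEquiv, Equiv.coe_fn_mk, Fin.prod_univ_succ (n := k + 1), Fin.cons_zero,
          Fin.cons_succ, Fin.tail_cons, and_self, if_true, map_mul]
        ring
      · intro y _ hy
        simp [Fin.consEquiv, hy]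
      · simp
    · intro y _ hy
      simp [Fin.consEquiv, hy]
    · simp
  have hmain := re_sum_perm_nonneg (fun F H => -φ (V F H)) fun z => by
    have h := hpos z
    simp only [mul_neg, Finset.sum_neg_distrib, Complex.neg_re]
    linarith
  simp only [Finset.sum_neg_distrib, ← map_sum, Complex.neg_re] at hmain
  have hV : ∑ τ : Equiv.Perm (Fin (k + 2)), ∑ F, V F (F ∘ τ) =
      ((((k + 1).factorial : ℝ)) : ℂ) •
        ((fun i P Q => if P.1 = Q.1 then ∑ y, T i (y, P.2) (y, Q.2) else 0 :
          Fin N → Fin dI × Fin dO → Fin dI × Fin dO → ℂ) +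
          ((k + 1 : ℝ) : ℂ) • T) := by
    funext i ⟨x, o⟩ ⟨x', o'⟩
    have h := sum_perm_kernel (fun f g => Tk i (f, o) (g, o'))
      (fun σ σ' f g => hsym i σ σ' f g o o') x x'
    rw [← (Fin.consEquiv fun _ => Fin dI).sum_comp fun g => Tk i (g, o) (g, o'),
      Fintype.sum_prod_type] at h
    simp only [Fin.consEquiv, Equiv.coe_fn_mk, ← hmarg] at h
    simp only [Finset.sum_apply, V, Pi.smul_apply, Pi.add_apply, smul_eq_mul]
    rw [h]
    push_cast
    rfl
  rw [hV, map_smul, map_add, map_smul, smul_eq_mul, smul_eq_mul, Complex.re_ofReal_mul,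
    Complex.add_re, Complex.re_ofReal_mul] at hmain
  have hfac : (0 : ℝ) < (k + 1).factorial := by positivity
  by_contra hcon
  push Not at hcon
  have := mul_pos hfac hcon
  linarith

lemma mem_convexHull_of_forall_symmetric_extension
    {T : Fin N → Fin dI × Fin dO → Fin dI × Fin dO → ℂ} {ρ : Matrix (Fin dI) (Fin dI) ℂ}
    (hρ : IsState ρ)
    (hTρ : ∀ a a' b b', ∑ i, T i (a, b) (a', b') = ρ a a' * (1 : Matrix (Fin dO) (Fin dO) ℂ) b b')
    (hext : ∀ k : ℕ, ∃ Tk : Fin N →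
        Matrix ((Fin (k + 1) → Fin dI) × Fin dO) ((Fin (k + 1) → Fin dI) × Fin dO) ℂ,
      IsTester Tk ∧
      (∀ (i : Fin N) (σ σ' : Equiv.Perm (Fin (k + 1)))
          (f g : Fin (k + 1) → Fin dI) (o o' : Fin dO),
        Tk i (f ∘ σ, o) (g ∘ σ', o') = Tk i (f, o) (g, o')) ∧
      (∀ (i : Fin N) (x x' : Fin dI) (o o' : Fin dO),
        T i (x, o) (x', o') =
          ∑ g : Fin k → Fin dI, Tk i (Fin.cons x g, o) (Fin.cons x' g, o'))) :
    T ∈ convexHull ℝ (pureMemoryless dI dO N) := by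
  rcases isEmpty_or_nonempty (Fin dO) with hO | hO
  · obtain ⟨x⟩ : Nonempty (Fin dI) := by
      by_contra h
      rw [not_nonempty_iff] at h
      simpa [Matrix.trace] using hρ.2
    refine subset_convexHull ℝ _ ⟨Pi.single x 1, fun _ => 0, ?_,
      ⟨fun _ => Matrix.PosSemidef.zero, Subsingleton.elim _ _⟩, Subsingleton.elim _ _⟩
    rw [Finset.sum_eq_single x] <;> simp +contextual
  by_contra hnot
  obtain ⟨f, u, hfS, hfT⟩ := RCLike.geometric_hahn_banach_closed_point (𝕜 := ℂ)
    (convex_convexHull ℝ (pureMemoryless dI dO N))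
    isCompact_pureMemoryless.convexHull_of_finiteDimensional.isClosed hnot
  let tr : (Fin N → Fin dI × Fin dO → Fin dI × Fin dO → ℂ) →ₗ[ℂ] ℂ :=
    { toFun := fun X => ∑ x, ∑ o, ∑ i, X i (x, o) (x, o)
      map_add' := fun X Y => by simp [Finset.sum_add_distrib]
      map_smul' := fun c X => by simp [Finset.mul_sum] }
  have htr : ∀ (X : Fin N → Fin dI × Fin dO → Fin dI × Fin dO → ℂ) (σ : Fin dI → ℂ),
      ∑ x, σ x = 1 → (∀ x o, ∑ i, X i (x, o) (x, o) = σ x) → tr X = dO := by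
    intro X σ hσ hX
    simp [tr, hX, ← Finset.mul_sum, hσ]
  have hdO : (dO : ℝ) ≠ 0 := by
    exact_mod_cast (Fin.pos_iff_nonempty.mpr hO).ne'
  let φ : (Fin N → Fin dI × Fin dO → Fin dI × Fin dO → ℂ) →ₗ[ℂ] ℂ :=
    f.toLinearMap - ((u / dO : ℝ) : ℂ) • tr
  have hφ : ∀ X, tr X = dO → (φ X).re = (f X).re - u := by
    intro X hX
    have : φ X = f X - ((u / dO : ℝ) : ℂ) * tr X := rfl
    rw [this, hX, Complex.sub_re, ← Complex.ofReal_natCast, ← Complex.ofReal_mul,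
      div_mul_cancel₀ _ hdO, Complex.ofReal_re]
  have hφS : ∀ X ∈ pureMemoryless dI dO N, (φ X).re ≤ 0 := by
    rintro X hX
    have hlt := hfS X (subset_convexHull ℝ _ hX)
    obtain ⟨ψ, M, hψ, hM, rfl⟩ := hX
    rw [hφ]
    · exact sub_nonpos.mpr hlt.le
    · refine htr _ (fun x => ((‖ψ x‖ ^ 2 : ℝ) : ℂ)) (by exact_mod_cast hψ) fun x o => ?_
      rw [← Finset.mul_sum, ← Matrix.sum_apply, hM.2, Complex.mul_conj']
      simp
  have hφT : 0 < (φ T).re := by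
    rw [hφ]
    · exact sub_pos.mpr hfT
    · exact htr _ (fun x => ρ x x) hρ.2 fun x o => by simp [hTρ]
  obtain ⟨k, hk⟩ := exists_nat_gt
    (-(φ fun i P Q => if P.1 = Q.1 then ∑ y, T i (y, P.2) (y, Q.2) else 0).re / (φ T).re)
  obtain ⟨Tk, hTk, hsym, hmarg⟩ := hext k
  have h := re_apply_symmetric_extension_nonpos hTk hsym hmarg φ hφS
  rw [div_lt_iff₀ hφT] at hk
  nlinarith

end SymmetricExtension

/-- A single-copy tester is a convex combination of memory-less testers if and
only if, for every number `k+1` of copies of the input system, it admits an extension to a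
single-copy tester on `(ℂ^{d_I})^{⊗(k+1)} ⊗ ℂ^{d_O}` supported on the symmetric subspace of the
input copies (tensored with the output), whose partial trace over all but one input copy
recovers the original tester. -/
theorem memoryless_tester_symmetric_extension {dI dO N : ℕ}
    (T : Fin N → Matrix (Fin dI × Fin dO) (Fin dI × Fin dO) ℂ)
    (hT : IsTester T) :
    IsConvexCombMemoryless T ↔
      ∀ k : ℕ,
        ∃ Tk : Fin N →
            Matrix ((Fin (k + 1) → Fin dI) × Fin dO) ((Fin (k + 1) → Fin dI) × Fin dO) ℂ,
          IsTester Tk ∧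
          (∀ (i : Fin N) (σ σ' : Equiv.Perm (Fin (k + 1)))
              (f g : Fin (k + 1) → Fin dI) (o o' : Fin dO),
            Tk i (f ∘ σ, o) (g ∘ σ', o') = Tk i (f, o) (g, o')) ∧
          (∀ (i : Fin N) (x x' : Fin dI) (o o' : Fin dO),
            T i (x, o) (x', o') =
              ∑ g : Fin k → Fin dI,
                Tk i (Fin.cons x g, o) (Fin.cons x' g, o')) := by
  constructor
  · exact fun h k => h.exists_symmetric_extension k
  · intro hext
    obtain ⟨ρ, hρ, hTρ⟩ := hT.exists_sum_eq
    exact isConvexCombMemoryless_of_mem_convexHull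
      (mem_convexHull_of_forall_symmetric_extension hρ hTρ hext)
end
end

section
/- For every d_E ≥ 1 and every nonzero vector ψ ∈ ℂ^{d_E}⊗ℂ²⊗ℂ², the four vectors (1_{d_E} ⊗ U_a ⊗ U_a)ψ for a ∈ {0,x,y,z} are not pairwise orthogonal, where U_0 = 1₂, U_x = (e^{iπ/4}/√2)[[1,i],[i,1]], U_y = (e^{iπ/4}/√2)[[1,−1],[1,1]], and U_z = diag(1,i) are the identity and the principal square roots of the Pauli matrices σ_x, σ_y, σ_z. -/
open Matrix BigOperators

noncomputable section

/-- The identity and the principal square roots of the three Pauli matrices. -/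
def sqrtPauli : Fin 4 → Matrix (Fin 2) (Fin 2) ℂ := fun a =>
  if a = 0 then 1
  else if a = 1 then
    (Complex.exp ((Real.pi : ℂ) * Complex.I / 4) / (Real.sqrt 2 : ℂ)) •
      !![1, Complex.I; Complex.I, 1]
  else if a = 2 then
    (Complex.exp ((Real.pi : ℂ) * Complex.I / 4) / (Real.sqrt 2 : ℂ)) •
      !![1, -1; 1, 1]
  else !![1, 0; 0, Complex.I]

/-- The action of `1_{d_E} ⊗ U ⊗ U` on a vector of `ℂ^{d_E} ⊗ ℂ² ⊗ ℂ²`. -/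
def applyIUU {dE : ℕ} (U : Matrix (Fin 2) (Fin 2) ℂ)
    (ψ : Fin dE × Fin 2 × Fin 2 → ℂ) : Fin dE × Fin 2 × Fin 2 → ℂ :=
  fun x => ∑ j : Fin 2, ∑ k : Fin 2, U x.2.1 j * U x.2.2 k * ψ (x.1, j, k)

lemma applyIUU_one {dE : ℕ} (ψ : Fin dE × Fin 2 × Fin 2 → ℂ) : applyIUU 1 ψ = ψ := by
  ext ⟨e, j, k⟩
  simp [applyIUU, Matrix.one_apply]

lemma applyIUU_smul {dE : ℕ} (c : ℂ) (U : Matrix (Fin 2) (Fin 2) ℂ)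
    (ψ : Fin dE × Fin 2 × Fin 2 → ℂ) : applyIUU (c • U) ψ = c ^ 2 • applyIUU U ψ := by
  ext x
  simp only [applyIUU, Matrix.smul_apply, Pi.smul_apply, smul_eq_mul, Finset.mul_sum]
  refine Finset.sum_congr rfl fun j _ => Finset.sum_congr rfl fun k _ => ?_
  ring

lemma sum_conj_mul_applyIUU_eq_zero_of_smul {dE : ℕ} {c : ℂ} (hc : c ≠ 0)
    {U : Matrix (Fin 2) (Fin 2) ℂ} {φ ψ : Fin dE × Fin 2 × Fin 2 → ℂ}
    (h : ∑ x, starRingEnd ℂ (φ x) * applyIUU (c • U) ψ x = 0) :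
    ∑ x, starRingEnd ℂ (φ x) * applyIUU U ψ x = 0 := by
  have h' : c ^ 2 * ∑ x, starRingEnd ℂ (φ x) * applyIUU U ψ x = 0 := by
    rw [← h, applyIUU_smul, Finset.mul_sum]
    refine Finset.sum_congr rfl fun x _ => ?_
    simp only [Pi.smul_apply, smul_eq_mul]
    ring
  exact (mul_eq_zero.mp h').resolve_left (pow_ne_zero 2 hc)

/-- The expectation of `1 ⊗ σ_x ⊗ σ_x` can only equal the squared norm on its `+1` eigenspace. -/
lemma eq_of_sqrt_pauli_x_orthogonal {dE : ℕ} {ψ : Fin dE × Fin 2 × Fin 2 → ℂ}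
    (h : ∑ x, starRingEnd ℂ (ψ x) * applyIUU !![1, Complex.I; Complex.I, 1] ψ x = 0)
    (e : Fin dE) : ψ (e, 0, 0) = ψ (e, 1, 1) := by
  have hsum : ∑ e, (Complex.normSq (ψ (e, 0, 0) - ψ (e, 1, 1)) +
      Complex.normSq (ψ (e, 0, 1) - ψ (e, 1, 0))) = 0 := by
    have hre := congrArg Complex.re h
    rw [Fintype.sum_prod_type, Complex.re_sum, Complex.zero_re] at hre
    rw [← hre]
    refine Finset.sum_congr rfl fun e _ => ?_
    simp [applyIUU, Fintype.sum_prod_type, Fin.sum_univ_two, Complex.normSq_apply]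
    ring
  rw [Finset.sum_eq_zero_iff_of_nonneg fun _ _ =>
    add_nonneg (Complex.normSq_nonneg _) (Complex.normSq_nonneg _)] at hsum
  have := hsum e (Finset.mem_univ e)
  rw [add_eq_zero_iff_of_nonneg (Complex.normSq_nonneg _) (Complex.normSq_nonneg _)] at this
  exact sub_eq_zero.mp (Complex.normSq_eq_zero.mp this.1)

/-- The expectation of `1 ⊗ σ_y ⊗ σ_y` can only equal the squared norm on its `+1` eigenspace. -/
lemma eq_neg_of_sqrt_pauli_y_orthogonal {dE : ℕ} {ψ : Fin dE × Fin 2 × Fin 2 → ℂ}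
    (h : ∑ x, starRingEnd ℂ (ψ x) * applyIUU !![1, -1; 1, 1] ψ x = 0)
    (e : Fin dE) : ψ (e, 0, 0) = -ψ (e, 1, 1) := by
  have hsum : ∑ e, (Complex.normSq (ψ (e, 0, 0) + ψ (e, 1, 1)) +
      Complex.normSq (ψ (e, 0, 1) - ψ (e, 1, 0))) = 0 := by
    have hre := congrArg Complex.re h
    rw [Fintype.sum_prod_type, Complex.re_sum, Complex.zero_re] at hre
    rw [← hre]
    refine Finset.sum_congr rfl fun e _ => ?_
    simp [applyIUU, Fintype.sum_prod_type, Fin.sum_univ_two, Complex.normSq_apply]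
    ring
  rw [Finset.sum_eq_zero_iff_of_nonneg fun _ _ =>
    add_nonneg (Complex.normSq_nonneg _) (Complex.normSq_nonneg _)] at hsum
  have := hsum e (Finset.mem_univ e)
  rw [add_eq_zero_iff_of_nonneg (Complex.normSq_nonneg _) (Complex.normSq_nonneg _)] at this
  exact eq_neg_of_add_eq_zero_left (Complex.normSq_eq_zero.mp this.1)

/-- The expectation of `1 ⊗ σ_z ⊗ σ_z` can only equal the squared norm on its `+1` eigenspace. -/
lemma eq_zero_of_sqrt_pauli_z_orthogonal {dE : ℕ} {ψ : Fin dE × Fin 2 × Fin 2 → ℂ}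
    (h : ∑ x, starRingEnd ℂ (ψ x) * applyIUU !![1, 0; 0, Complex.I] ψ x = 0)
    (e : Fin dE) : ψ (e, 0, 1) = 0 ∧ ψ (e, 1, 0) = 0 := by
  have hsum : ∑ e, (Complex.normSq (ψ (e, 0, 1)) + Complex.normSq (ψ (e, 1, 0))) = 0 := by
    have him := congrArg Complex.im h
    rw [Fintype.sum_prod_type, Complex.im_sum, Complex.zero_im] at him
    rw [← him]
    refine Finset.sum_congr rfl fun e _ => ?_
    simp [applyIUU, Fintype.sum_prod_type, Fin.sum_univ_two, Complex.normSq_apply]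
    ring
  rw [Finset.sum_eq_zero_iff_of_nonneg fun _ _ =>
    add_nonneg (Complex.normSq_nonneg _) (Complex.normSq_nonneg _)] at hsum
  have := hsum e (Finset.mem_univ e)
  rwa [add_eq_zero_iff_of_nonneg (Complex.normSq_nonneg _) (Complex.normSq_nonneg _),
    Complex.normSq_eq_zero, Complex.normSq_eq_zero] at this

/-- For every memory dimension `d_E ≥ 1` and every nonzero vector
`ψ ∈ ℂ^{d_E} ⊗ ℂ² ⊗ ℂ²`, the four vectors `(1 ⊗ U_a ⊗ U_a)ψ`, `a ∈ {0,x,y,z}`, are not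
pairwise orthogonal. -/
theorem sqrt_pauli_outputs_not_pairwise_orthogonal (dE : ℕ) (hdE : 1 ≤ dE)
    (ψ : Fin dE × Fin 2 × Fin 2 → ℂ) (hψ : ψ ≠ 0) :
    ¬ (∀ a b : Fin 4, a ≠ b →
        (∑ x : Fin dE × Fin 2 × Fin 2,
          starRingEnd ℂ (applyIUU (sqrtPauli a) ψ x) * applyIUU (sqrtPauli b) ψ x) = 0) := by
  intro h
  have hc : Complex.exp ((Real.pi : ℂ) * Complex.I / 4) / (Real.sqrt 2 : ℂ) ≠ 0 :=
    div_ne_zero (Complex.exp_ne_zero _)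
      (Complex.ofReal_ne_zero.mpr (Real.sqrt_ne_zero'.mpr two_pos))
  have hx := h 0 1 (by decide)
  have hy := h 0 2 (by decide)
  have hz := h 0 3 (by decide)
  rw [show sqrtPauli 0 = 1 from rfl, applyIUU_one] at hx hy hz
  have h00 := eq_of_sqrt_pauli_x_orthogonal (sum_conj_mul_applyIUU_eq_zero_of_smul hc hx)
  have h11 := eq_neg_of_sqrt_pauli_y_orthogonal (sum_conj_mul_applyIUU_eq_zero_of_smul hc hy)
  have h01 := eq_zero_of_sqrt_pauli_z_orthogonal hz
  have hs : ∀ e, ψ (e, 1, 1) = 0 := fun e => self_eq_neg.mp ((h00 e).symm.trans (h11 e))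
  refine hψ (funext fun ⟨e, j, k⟩ => ?_)
  fin_cases j <;> fin_cases k
  · exact (h00 e).trans (hs e)
  · exact (h01 e).1
  · exact (h01 e).2
  · exact hs e
end
end

section
/- Let {C^i}_{i=1}^N be Choi matrices of quantum channels from ℂ^{d_I} to ℂ^{d_O} (positive semidefinite matrices on ℂ^{d_I}⊗ℂ^{d_O} with Tr_O(C^i) = 1_{d_I}). For every memory-(d_{E₁},d_{E₂}) two-copy adaptive tester without additional classical memory {T^i}_{i=1}^N, the success probability on the uniform two-copy ensemble satisfies (1/N)∑_{i=1}^N Tr(T^i (C^i ⊗ C^i)) ≤ min{ d_O·d_{E₂}/N , 1 }. -/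
open Matrix BigOperators ComplexOrder

noncomputable section

/-- The iterated link product `ρ_{I₁E₁} * K_{E₁O₁I₂E₂} * (M_{E₂O₂})ᵀ`, written out entrywise on
the system `I₁ ⊗ O₁ ⊗ I₂ ⊗ O₂`. -/
def adaptT {dI1 dO1 dI2 dO2 dE1 dE2 : ℕ}
    (ρ : Matrix (Fin dI1 × Fin dE1) (Fin dI1 × Fin dE1) ℂ)
    (K : Matrix (Fin dE1 × Fin dO1 × Fin dI2 × Fin dE2)
                (Fin dE1 × Fin dO1 × Fin dI2 × Fin dE2) ℂ)
    (M : Matrix (Fin dE2 × Fin dO2) (Fin dE2 × Fin dO2) ℂ) :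
    Matrix (Fin dI1 × Fin dO1 × Fin dI2 × Fin dO2)
           (Fin dI1 × Fin dO1 × Fin dI2 × Fin dO2) ℂ :=
  Matrix.of fun p q =>
    ∑ e : Fin dE1, ∑ f : Fin dE1, ∑ ε : Fin dE2, ∑ φ : Fin dE2,
      ρ (p.1, f) (q.1, e) *
      K (f, p.2.1, p.2.2.1, φ) (e, q.2.1, q.2.2.1, ε) *
      M (ε, q.2.2.2) (φ, p.2.2.2)

/-- `C ⊗ C` on the system `I₁ ⊗ O₁ ⊗ I₂ ⊗ O₂` (two copies of an `I → O` Choi matrix). -/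
def choiPair {dI dO : ℕ} (C : Matrix (Fin dI × Fin dO) (Fin dI × Fin dO) ℂ) :
    Matrix (Fin dI × Fin dO × Fin dI × Fin dO) (Fin dI × Fin dO × Fin dI × Fin dO) ℂ :=
  Matrix.of fun p q =>
    C (p.1, p.2.1) (q.1, q.2.1) * C (p.2.2.1, p.2.2.2) (q.2.2.1, q.2.2.2)

namespace Matrix

/-- Contracting a common factor `a` of two positive semidefinite matrices gives a positive
semidefinite matrix. -/
theorem PosSemidef.contract_s8 {a r m n : Type*} [Fintype a] [Fintype r] [Fintype m] [Fintype n]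
    {A : Matrix m m ℂ} {B : Matrix n n ℂ} (hA : A.PosSemidef) (hB : B.PosSemidef)
    (f : a × r → m) (g : a × r → n) :
    (of fun s t : r => ∑ i, ∑ j, A (f (i, s)) (f (j, t)) * B (g (i, s)) (g (j, t))).PosSemidef := by
  classical
  have h := (hA.submatrix f).hadamard (hB.submatrix g)
  have hV := h.conjTranspose_mul_mul_same
    (of fun (u : a × r) s => if u.2 = s then (1 : ℂ) else 0)
  refine (congrArg PosSemidef ?_).mp hV
  ext s t
  simp only [Matrix.mul_apply, Fintype.sum_prod_type, conjTranspose_apply, of_apply,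
    hadamard_apply, submatrix_apply, apply_ite star, star_one, star_zero, ite_mul, one_mul,
    zero_mul, mul_ite, mul_one, mul_zero, Finset.sum_ite_eq', Finset.mem_univ, if_true]
  exact Finset.sum_comm

theorem PosSemidef.trace_mul_nonneg {n : Type*} [Fintype n]
    {A B : Matrix n n ℂ} (hA : A.PosSemidef) (hB : B.PosSemidef) : 0 ≤ (A * B).trace := by
  have h := (hA.contract_s8 hB.transpose (a := n) (r := Unit) Prod.fst Prod.fst).trace_nonneg
  simpa [trace, Matrix.mul_apply] using h

theorem PosSemidef.one_sub_of_trace_eq_one {n : Type*} [Fintype n] [DecidableEq n]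
    {A : Matrix n n ℂ} (hA : A.PosSemidef) (hA1 : A.trace = 1) : (1 - A).PosSemidef := by
  have hsum : ∑ i, hA.1.eigenvalues i = 1 := by
    have h := hA.1.trace_eq_sum_eigenvalues
    rw [hA1] at h
    simpa using (congrArg Complex.re h).symm
  have hle (i : n) : hA.1.eigenvalues i ≤ 1 :=
    hsum ▸ Finset.single_le_sum (fun j _ => hA.eigenvalues_nonneg j) (Finset.mem_univ i)
  have hD : (1 - diagonal (RCLike.ofReal ∘ hA.1.eigenvalues : n → ℂ)).PosSemidef := by
    rw [← diagonal_one, diagonal_sub, posSemidef_diagonal_iff]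
    intro i
    exact sub_nonneg.2 (Complex.real_le_real.2 (hle i))
  rw [hA.1.spectral_theorem, ← map_one (Unitary.conjStarAlgAut ℂ _ hA.1.eigenvectorUnitary),
    ← map_sub, Unitary.conjStarAlgAut_apply]
  exact hD.mul_mul_conjTranspose_same _

end Matrix

/-- The joint state of the memory and the output of the channel with Choi matrix `C`, used on the
input part of `ρ`. -/
def outputState {dI dO dE1 : ℕ}
    (C : Matrix (Fin dI × Fin dO) (Fin dI × Fin dO) ℂ)
    (ρ : Matrix (Fin dI × Fin dE1) (Fin dI × Fin dE1) ℂ) :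
    Matrix (Fin dE1 × Fin dO) (Fin dE1 × Fin dO) ℂ :=
  of fun u v => ∑ x, ∑ x', ρ (x, u.1) (x', v.1) * Cᵀ (x, u.2) (x', v.2)

/-- The joint state of the second channel input `I₂` and the memory `E₂`. -/
def inputState {dI dO dE1 dE2 : ℕ}
    (K : Matrix (Fin dE1 × Fin dO × Fin dI × Fin dE2) (Fin dE1 × Fin dO × Fin dI × Fin dE2) ℂ)
    (σ : Matrix (Fin dE1 × Fin dO) (Fin dE1 × Fin dO) ℂ) :
    Matrix (Fin dI × Fin dE2) (Fin dI × Fin dE2) ℂ :=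
  of fun u v => ∑ s, ∑ t, K (s.1, s.2, u) (t.1, t.2, v) * σ s t

section

variable {dI dO dE1 dE2 : ℕ} {C : Matrix (Fin dI × Fin dO) (Fin dI × Fin dO) ℂ}
  {ρ : Matrix (Fin dI × Fin dE1) (Fin dI × Fin dE1) ℂ}
  {K : Matrix (Fin dE1 × Fin dO × Fin dI × Fin dE2) (Fin dE1 × Fin dO × Fin dI × Fin dE2) ℂ}
  {σ : Matrix (Fin dE1 × Fin dO) (Fin dE1 × Fin dO) ℂ}

theorem isState_outputState (hC : C.PosSemidef)
    (hCtr : ∀ x x' : Fin dI, (∑ o : Fin dO, C (x, o) (x', o)) = if x = x' then 1 else 0)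
    (hρ : IsState ρ) : IsState (outputState C ρ) := by
  refine ⟨hρ.1.contract_s8 hC.transpose (a := Fin dI) (r := Fin dE1 × Fin dO)
    (fun p => (p.1, p.2.1)) (fun p => (p.1, p.2.2)), ?_⟩
  rw [← hρ.2]
  have h (e : Fin dE1) : ∑ o, outputState C ρ (e, o) (e, o) = ∑ x, ρ (x, e) (x, e) := by
    simp only [outputState, of_apply, transpose_apply]
    rw [Finset.sum_comm]
    refine Finset.sum_congr rfl fun x _ => ?_
    rw [Finset.sum_comm]
    simp [← Finset.mul_sum, hCtr]
  simp only [trace, diag_apply, Fintype.sum_prod_type, h]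
  exact Finset.sum_comm

theorem isState_inputState (hK : K.PosSemidef)
    (hKtr : ∀ (e e' : Fin dE1) (o o' : Fin dO),
      (∑ x : Fin dI, ∑ ε : Fin dE2, K (e, o, x, ε) (e', o', x, ε)) =
        if e = e' ∧ o = o' then 1 else 0)
    (hσ : IsState σ) : IsState (inputState K σ) := by
  refine ⟨hK.contract_s8 hσ.1 (a := Fin dE1 × Fin dO) (r := Fin dI × Fin dE2)
    (fun p => (p.1.1, p.1.2, p.2)) Prod.fst, ?_⟩
  rw [← hσ.2]
  have h (s t : Fin dE1 × Fin dO) :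
      ∑ u, K (s.1, s.2, u) (t.1, t.2, u) = if s = t then 1 else 0 := by
    simp only [Fintype.sum_prod_type, hKtr, Prod.ext_iff]
  simp only [trace, diag_apply, inputState, of_apply]
  rw [Finset.sum_comm]
  refine Finset.sum_congr rfl fun s _ => ?_
  rw [Finset.sum_comm]
  simp [← Finset.sum_mul, h]

/-- The tester's outcome statistics are those of measuring `M` on the joint state of the memory
`E₂` and the output `O₂` of the second channel use. -/
theorem trace_adaptT_mul_choiPair (M : Matrix (Fin dE2 × Fin dO) (Fin dE2 × Fin dO) ℂ) :
    trace (adaptT ρ K M * choiPair C) =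
      trace (M * outputState C (inputState K (outputState C ρ))) := by
  let l : (Fin dI × Fin dO × Fin dI × Fin dO) × (Fin dI × Fin dO × Fin dI × Fin dO) ×
      Fin dE1 × Fin dE1 × Fin dE2 × Fin dE2 → ℂ := fun ((x, o, y, z), (x', o', y', z'), e, f, ε, φ) =>
    ρ (x, f) (x', e) * K (f, o, y, φ) (e, o', y', ε) * M (ε, z') (φ, z) *
      (C (x', o') (x, o) * C (y', z') (y, z))
  let r : (Fin dE2 × Fin dO) × (Fin dE2 × Fin dO) × Fin dI × Fin dI ×
      (Fin dE1 × Fin dO) × (Fin dE1 × Fin dO) × Fin dI × Fin dI → ℂ :=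
    fun ((ε, z'), (φ, z), y, y', (f, o), (e, o'), x, x') =>
    M (ε, z') (φ, z) * (K (f, o, y, φ) (e, o', y', ε) * (ρ (x, f) (x', e) * C (x', o') (x, o)) *
      C (y', z') (y, z))
  have hl : trace (adaptT ρ K M * choiPair C) = ∑ w, l w := by
    simp only [trace, diag_apply, Matrix.mul_apply, adaptT, choiPair, of_apply, Finset.sum_mul]
    iterate 5 refine (Finset.sum_congr rfl fun _ _ => ?_).trans (Fintype.sum_prod_type _).symm
    rfl
  have hr : trace (M * outputState C (inputState K (outputState C ρ))) = ∑ w, r w := by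
    simp only [trace, diag_apply, Matrix.mul_apply, outputState, inputState, of_apply,
      transpose_apply, Finset.mul_sum, Finset.sum_mul]
    iterate 7 refine (Finset.sum_congr rfl fun _ _ => ?_).trans (Fintype.sum_prod_type _).symm
    rfl
  rw [hl, hr]
  refine Fintype.sum_equiv
    ⟨fun ((x, o, y, z), (x', o', y', z'), e, f, ε, φ) =>
      ((ε, z'), (φ, z), y, y', (f, o), (e, o'), x, x'),
    fun ((ε, z'), (φ, z), y, y', (f, o), (e, o'), x, x') =>
      ((x, o, y, z), (x', o', y', z'), e, f, ε, φ), fun _ => rfl, fun _ => rfl⟩ _ _ ?_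
  rintro ⟨⟨x, o, y, z⟩, ⟨x', o', y', z'⟩, e, f, ε, φ⟩
  simp only [Equiv.coe_fn_mk, l, r]
  ring

end

/-- For any uniform ensemble of `N` channels and any
memory-`(d_{E₁}, d_{E₂})` two-copy adaptive tester without additional classical memory, the
success probability is at most `min{d_O d_{E₂}/N, 1}`. -/
theorem adaptive_no_classical_memory_bound {dI dO dE1 dE2 N : ℕ}
    (C : Fin N → Matrix (Fin dI × Fin dO) (Fin dI × Fin dO) ℂ)
    (hC : ∀ i, (C i).PosSemidef ∧
      ∀ x x' : Fin dI, (∑ o : Fin dO, C i (x, o) (x', o)) = if x = x' then 1 else 0)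
    (ρ : Matrix (Fin dI × Fin dE1) (Fin dI × Fin dE1) ℂ) (hρ : IsState ρ)
    (K : Matrix (Fin dE1 × Fin dO × Fin dI × Fin dE2)
                (Fin dE1 × Fin dO × Fin dI × Fin dE2) ℂ)
    (hK : K.PosSemidef)
    (hKtr : ∀ (e e' : Fin dE1) (o o' : Fin dO),
      (∑ x : Fin dI, ∑ ε : Fin dE2, K (e, o, x, ε) (e', o', x, ε)) =
        if e = e' ∧ o = o' then 1 else 0)
    (M : Fin N → Matrix (Fin dE2 × Fin dO) (Fin dE2 × Fin dO) ℂ) (hM : IsPOVM M) :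
    (1 / N : ℝ) * (∑ i, Matrix.trace (adaptT ρ K (M i) * choiPair (C i))).re ≤
      min ((dO : ℝ) * dE2 / N) 1 := by
  have hQ (i : Fin N) := isState_outputState (hC i).1 (hC i).2
    (isState_inputState hK hKtr (isState_outputState (hC i).1 (hC i).2 hρ))
  simp only [trace_adaptT_mul_choiPair]
  set Q := fun i => outputState (C i) (inputState K (outputState (C i) ρ))
  have hle_trace : ∑ i, (M i * Q i).trace ≤ dE2 * dO := by
    calc ∑ i, (M i * Q i).trace ≤ ∑ i, (M i).trace := by
          refine Finset.sum_le_sum fun i _ => ?_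
          have h := (hM.1 i).trace_mul_nonneg ((hQ i).1.one_sub_of_trace_eq_one (hQ i).2)
          rw [Matrix.mul_sub, Matrix.mul_one, trace_sub] at h
          exact sub_nonneg.1 h
      _ = dE2 * dO := by simp [← trace_sum, hM.2]
  have hle_card : ∑ i, (M i * Q i).trace ≤ N := by
    calc ∑ i, (M i * Q i).trace ≤ ∑ i, (∑ j, M j * Q i).trace := by
          refine Finset.sum_le_sum fun i _ => ?_
          rw [trace_sum]
          exact Finset.single_le_sum (f := fun j => (M j * Q i).trace)
            (fun j _ => (hM.1 j).trace_mul_nonneg (hQ i).1) (Finset.mem_univ i)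
      _ = N := by simp [← Finset.sum_mul, hM.2, Q, (hQ _).2]
  rw [one_div_mul_eq_div]
  have h1 := (Complex.le_def.1 hle_trace).1
  have h2 := (Complex.le_def.1 hle_card).1
  rw [← Nat.cast_mul, Complex.natCast_re, Nat.cast_mul, mul_comm] at h1
  rw [Complex.natCast_re] at h2
  exact le_min (div_le_div_of_nonneg_right h1 N.cast_nonneg) (div_le_one_of_le₀ h2 N.cast_nonneg)
end
end

section
/- The sets of two-copy parallel testers and two-copy classically adaptive testers are incomparable: (i) the family T^i := |φ¹⟩⟨φ¹|_{I₁I₂} ⊗ |φ^i⟩⟨φ^i|_{O₁O₂} (i = 1,…,4), where |φ^1⟩,…,|φ^4⟩ are the four two-qubit Bell states, is a two-copy parallel tester (∑_i T^i = |φ¹⟩⟨φ¹| ⊗ 1₄) but admits no classically adaptive decomposition T^i = ∑_{j=1}^L R^j ⊗ S^{i|j} with positive semidefinite R^j on I₁O₁ and S^{i|j} on I₂O₂, since each T^i is entangled across the bipartition I₁O₁|I₂O₂; (ii) the family T^i := ∑_{j∈{0,1}} |0⟩⟨0|_{I₁} ⊗ |j⟩⟨j|_{O₁} ⊗ |j⟩⟨j|_{I₂}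 ⊗ |i⟩⟨i|_{O₂} (i ∈ {0,1}) on four qubits is a two-copy classically adaptive tester but is not a parallel tester, since ∑_i T^i is not of the form σ_{I₁I₂} ⊗ 1_{O₁O₂} for any state σ_{I₁I₂}. -/
open Matrix BigOperators ComplexOrder

noncomputable section

/-- The four two-qubit Bell states
`|φ¹⟩=(|00⟩+|11⟩)/√2`, `|φ²⟩=(|01⟩+|10⟩)/√2`, `|φ³⟩=(|01⟩−|10⟩)/√2`, `|φ⁴⟩=(|00⟩−|11⟩)/√2`,
indexed here by `Fin 4` starting at `0`. -/
def bellVec : Fin 4 → (Fin 2 × Fin 2 → ℂ) := fun i p =>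
  if i = 0 then (if p.1 = p.2 then ((Real.sqrt 2 : ℂ))⁻¹ else 0)
  else if i = 1 then (if p.1 ≠ p.2 then ((Real.sqrt 2 : ℂ))⁻¹ else 0)
  else if i = 2 then
    (if p = (0, 1) then ((Real.sqrt 2 : ℂ))⁻¹
     else if p = (1, 0) then -((Real.sqrt 2 : ℂ))⁻¹ else 0)
  else
    (if p = (0, 0) then ((Real.sqrt 2 : ℂ))⁻¹
     else if p = (1, 1) then -((Real.sqrt 2 : ℂ))⁻¹ else 0)

/-- The rank-one projection `|φ^i⟩⟨φ^i|` onto a Bell state. -/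
def bellProj (i : Fin 4) : Matrix (Fin 2 × Fin 2) (Fin 2 × Fin 2) ℂ :=
  Matrix.of fun p q => bellVec i p * starRingEnd ℂ (bellVec i q)

/-- The parallel tester `T^i = |φ¹⟩⟨φ¹|_{I₁I₂} ⊗ |φ^i⟩⟨φ^i|_{O₁O₂}`,
written on the index ordering `I₁ ⊗ O₁ ⊗ I₂ ⊗ O₂`. -/
def Tpar (i : Fin 4) :
    Matrix (Fin 2 × Fin 2 × Fin 2 × Fin 2) (Fin 2 × Fin 2 × Fin 2 × Fin 2) ℂ :=
  Matrix.of fun p q =>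
    bellProj 0 (p.1, p.2.2.1) (q.1, q.2.2.1) * bellProj i (p.2.1, p.2.2.2) (q.2.1, q.2.2.2)

/-- The classically adaptive tester
`T^i = ∑_{j∈{0,1}} |0⟩⟨0|_{I₁} ⊗ |j⟩⟨j|_{O₁} ⊗ |j⟩⟨j|_{I₂} ⊗ |i⟩⟨i|_{O₂}`,
written on the index ordering `I₁ ⊗ O₁ ⊗ I₂ ⊗ O₂`. -/
def Tca (i : Fin 2) :
    Matrix (Fin 2 × Fin 2 × Fin 2 × Fin 2) (Fin 2 × Fin 2 × Fin 2 × Fin 2) ℂ :=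
  Matrix.of fun p q =>
    ∑ j : Fin 2,
      (if p.1 = 0 then (1 : ℂ) else 0) * (if q.1 = 0 then 1 else 0) *
      (if p.2.1 = j then 1 else 0) * (if q.2.1 = j then 1 else 0) *
      (if p.2.2.1 = j then 1 else 0) * (if q.2.2.1 = j then 1 else 0) *
      (if p.2.2.2 = i then 1 else 0) * (if q.2.2.2 = i then 1 else 0)

theorem Matrix.PosSemidef.apply_eq_zero_of_apply_self_eq_zero_left {n : Type*} [Fintype n]
    [DecidableEq n] {M : Matrix n n ℂ} (hM : M.PosSemidef) {a : n} (ha : M a a = 0) (b : n) :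
    M a b = 0 := by
  have hmul : M *ᵥ Pi.single a 1 = 0 := by
    rw [← hM.dotProduct_mulVec_zero_iff]
    simpa [Pi.single_apply] using ha
  have hba : M b a = 0 := by simpa using congrFun hmul b
  rw [← hM.isHermitian.apply, hba, star_zero]

theorem Matrix.PosSemidef.apply_eq_zero_of_apply_self_eq_zero_right {n : Type*} [Fintype n]
    [DecidableEq n] {M : Matrix n n ℂ} (hM : M.PosSemidef) {b : n} (hb : M b b = 0) (a : n) :
    M a b = 0 := by
  rw [← hM.isHermitian.apply, hM.apply_eq_zero_of_apply_self_eq_zero_left hb, star_zero]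

/-- In a separable matrix, vanishing of the diagonal entry at `(a, b)` forces vanishing of the
entry in row `(a, a)` and column `(b, b)`. -/
theorem sum_mul_eq_zero_of_diagonal_eq_zero {n ι : Type*} [Fintype n] [DecidableEq n] [Fintype ι]
    {R S : ι → Matrix n n ℂ} (hR : ∀ j, (R j).PosSemidef) (hS : ∀ j, (S j).PosSemidef) {a b : n}
    (h : ∑ j, R j a a * S j b b = 0) : ∑ j, R j a b * S j a b = 0 := by
  refine Finset.sum_eq_zero fun j hj => ?_
  have hj0 : R j a a * S j b b = 0 :=
    (Finset.sum_eq_zero_iff_of_nonneg fun j _ =>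
      mul_nonneg (hR j).diag_nonneg (hS j).diag_nonneg).1 h j hj
  rcases mul_eq_zero.1 hj0 with h0 | h0
  · rw [(hR j).apply_eq_zero_of_apply_self_eq_zero_left h0, zero_mul]
  · rw [(hS j).apply_eq_zero_of_apply_self_eq_zero_right h0, mul_zero]

theorem inv_sqrt_two_mul_self : ((Real.sqrt 2 : ℂ))⁻¹ * ((Real.sqrt 2 : ℂ))⁻¹ = 1 / 2 := by
  rw [← mul_inv, ← Complex.ofReal_mul, Real.mul_self_sqrt zero_le_two]
  norm_num

theorem sum_bellProj : ∑ i, bellProj i = 1 := by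
  ext ⟨a, b⟩ ⟨c, d⟩
  fin_cases a <;> fin_cases b <;> fin_cases c <;> fin_cases d <;>
    simp [Fin.sum_univ_four, bellProj, bellVec, inv_sqrt_two_mul_self] <;>
    norm_num

theorem isState_single {n : Type*} [Fintype n] [DecidableEq n] (a : n) :
    IsState (Matrix.diagonal (Pi.single a (1 : ℂ))) :=
  ⟨Matrix.PosSemidef.diagonal (Pi.single_nonneg.2 zero_le_one), by simp [Matrix.trace_diagonal]⟩

/-- Parallel and classically adaptive two-copy testers are incomparable:
(i) the Bell-state tester `Tpar` is a parallel tester (`∑_i T^i = |φ¹⟩⟨φ¹| ⊗ 1₄`) but admits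
no decomposition `T^i = ∑_j R^j ⊗ S^{i|j}` with positive semidefinite factors across
`I₁O₁ | I₂O₂`; (ii) the tester `Tca` is a two-copy classically adaptive tester but is not a
parallel tester: `∑_i T^i` is not of the form `σ_{I₁I₂} ⊗ 1_{O₁O₂}` for any state `σ`. -/
theorem parallel_and_classically_adaptive_incomparable :
    (∀ p q, (∑ i, Tpar i) p q =
        bellProj 0 (p.1, p.2.2.1) (q.1, q.2.2.1) *
          (if p.2.1 = q.2.1 then 1 else 0) * (if p.2.2.2 = q.2.2.2 then 1 else 0)) ∧
    (¬ ∃ (L : ℕ) (R : Fin L → Matrix (Fin 2 × Fin 2) (Fin 2 × Fin 2) ℂ)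
        (S : Fin 4 → Fin L → Matrix (Fin 2 × Fin 2) (Fin 2 × Fin 2) ℂ),
        (∀ j, (R j).PosSemidef) ∧ (∀ i j, (S i j).PosSemidef) ∧
        (∀ i p q, Tpar i p q =
          ∑ j, R j (p.1, p.2.1) (q.1, q.2.1) *
               S i j (p.2.2.1, p.2.2.2) (q.2.2.1, q.2.2.2))) ∧
    (∃ (L : ℕ) (R : Fin L → Matrix (Fin 2 × Fin 2) (Fin 2 × Fin 2) ℂ)
        (S : Fin 2 → Fin L → Matrix (Fin 2 × Fin 2) (Fin 2 × Fin 2) ℂ)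
        (ρ : Matrix (Fin 2) (Fin 2) ℂ)
        (σs : Fin L → Matrix (Fin 2) (Fin 2) ℂ),
        (∀ j, (R j).PosSemidef) ∧ IsState ρ ∧
        (∀ (x x' : Fin 2) (o o' : Fin 2),
          (∑ j, R j (x, o) (x', o')) = ρ x x' * (if o = o' then 1 else 0)) ∧
        (∀ i j, (S i j).PosSemidef) ∧ (∀ j, IsState (σs j)) ∧
        (∀ (j : Fin L) (x x' : Fin 2) (o o' : Fin 2),
          (∑ i, S i j (x, o) (x', o')) = σs j x x' * (if o = o' then 1 else 0)) ∧
        (∀ i p q, Tca i p q =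
          ∑ j, R j (p.1, p.2.1) (q.1, q.2.1) *
               S i j (p.2.2.1, p.2.2.2) (q.2.2.1, q.2.2.2))) ∧
    (¬ ∃ σ12 : Matrix (Fin 2 × Fin 2) (Fin 2 × Fin 2) ℂ,
        IsState σ12 ∧
        ∀ p q, (∑ i, Tca i) p q =
          σ12 (p.1, p.2.2.1) (q.1, q.2.2.1) *
            (if p.2.1 = q.2.1 then 1 else 0) * (if p.2.2.2 = q.2.2.2 then 1 else 0)) := by
  refine ⟨fun p q => ?_, ?_, ?_, ?_⟩
  · simp only [Matrix.sum_apply, Tpar, Matrix.of_apply]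
    rw [← Finset.mul_sum, ← Matrix.sum_apply, sum_bellProj, Matrix.one_apply, mul_assoc]
    by_cases h : p.2.1 = q.2.1 <;> simp [h]
  · rintro ⟨L, R, S, hR, hS, hT⟩
    have hdiag : ∑ j, R j (0, 0) (0, 0) * S 0 j (1, 0) (1, 0) = 0 := by
      rw [← hT 0 (0, 0, 1, 0) (0, 0, 1, 0)]
      simp [Tpar, bellProj, bellVec]
    have hoff := sum_mul_eq_zero_of_diagonal_eq_zero hR (hS 0) hdiag
    rw [← hT 0 (0, 0, 0, 0) (1, 0, 1, 0)] at hoff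
    simp [Tpar, bellProj, bellVec] at hoff
  · refine ⟨2, fun j => Matrix.diagonal (Pi.single (0, j) 1),
      fun i j => Matrix.diagonal (Pi.single (j, i) 1), Matrix.diagonal (Pi.single 0 1),
      fun j => Matrix.diagonal (Pi.single j 1), fun j => (isState_single _).1, isState_single _,
      ?_, fun i j => (isState_single _).1, fun j => isState_single _, ?_, ?_⟩
    · intro x x' o o'
      by_cases hx : x = 0 <;> by_cases ho : o = o' <;>
        simp [Matrix.diagonal_apply, Pi.single_apply, hx, ho]
    · intro j x x' o o'
      by_cases hx : x = j <;> by_cases ho : o = o' <;>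
        simp [Matrix.diagonal_apply, Pi.single_apply, hx, ho]
    · rintro i ⟨a, b, c, d⟩ ⟨a', b', c', d'⟩
      simp only [Tca, Matrix.of_apply]
      refine Finset.sum_congr rfl fun j _ => ?_
      simp only [Matrix.diagonal_apply, Pi.single_apply, Prod.mk.injEq]
      grind
  · rintro ⟨σ, -, h⟩
    have h₀ := h (0, 0, 0, 0) (0, 0, 0, 0)
    have h₁ := h (0, 1, 0, 0) (0, 1, 0, 0)
    simp [Matrix.sum_apply, Tca] at h₀ h₁
    exact one_ne_zero (h₀.trans h₁.symm)
end
end
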